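/- There are, up to isomorphism, exactly six (2)-pancyclic graphs on 17 vertices with at most 22 edges. -/

import Mathlib

open SimpleGraph

/-- The number of cycles of length `k` in `G`, counted as subgraphs of `G`
isomorphic to the cycle graph `C_k`. -/
noncomputable def cycleCount {V : Type*} (G : SimpleGraph V) (k : ℕ) : ℕ :=
  {H : G.Subgraph | Nonempty (H.coe ≃g cycleGraph k)}.ncard

/-- A graph on `v ≥ 3` vertices is `(r)`-pancyclic if it contains precisely `r`
cycles of every length from `3` to `v`. -/
def IsRPancyclic {V : Type*} [Fintype V] (G : SimpleGraph V) (r : ℕ) : Prop :=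
  3 ≤ Fintype.card V ∧
    ∀ k : ℕ, 3 ≤ k → k ≤ Fintype.card V → cycleCount G k = r

/-- There are, up to isomorphism, exactly `N` graphs on `v` vertices with at most
`b` edges satisfying the given pancyclicity property with parameter `r`. -/
def ExactlyNUpToIso (r N v b : ℕ) : Prop :=
  ∃ Gs : Fin N → SimpleGraph (Fin v),
    (∀ i j : Fin N, i ≠ j → IsEmpty (Gs i ≃g Gs j)) ∧
    (∀ i : Fin N, IsRPancyclic (Gs i) r ∧ (Gs i).edgeSet.ncard ≤ b) ∧
    (∀ (W : Type) [Fintype W] (G : SimpleGraph W), Fintype.card W = v →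
      G.edgeSet.ncard ≤ b → IsRPancyclic G r → ∃ i : Fin N, Nonempty (G ≃g Gs i))



structure Ent where
  m : ℕ
  t : ℕ
  l : List ℕ

inductive CL where
  | nil : CL
  | cons (p v : ℕ) (tl : CL) : CL

noncomputable def sel {α : Type} (b : Bool) (x y : α) : α := Bool.rec y x b

noncomputable def okN (N : ℕ) (l : List ℕ) (x : ℕ) : ℕ :=
  List.rec x (fun q _ ih => Nat.rec 0 (fun _ _ => ih) (Nat.mod (Nat.land q N) N)) l

noncomputable def contrib (p : ℕ) (e : Ent) : ℕ :=
  (fun M =>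
    Nat.add (okN M e.l (Nat.pow 16 (Nat.sub (Nat.add 18 e.t) (Nat.mod M 31))))
      (okN (Nat.xor M 1247923426698972051309601) e.l
        (Nat.pow 16 (Nat.add (Nat.mod M 31) (Nat.succ e.t))))) (Nat.xor e.m p)

/-- add contributions; `0` on overflow -/
noncomputable def addAll (es : List Ent) (p base : ℕ) : ℕ → ℕ :=
  List.rec (fun v => v)
    (fun e _ ih v => (fun v' => Nat.rec (ih v') (fun _ _ => 0)
      (Nat.land (Nat.add base v') 2518595457530477447304)) (Nat.add v (contrib p e))) es

noncomputable def xorL (p : ℕ) (l : List ℕ) : List ℕ :=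
  List.rec [] (fun q _ ih => Nat.xor q p :: ih) l

noncomputable def appL {α : Type} (l l' : List α) : List α :=
  List.rec l' (fun q _ ih => q :: ih) l

noncomputable def extE (p : ℕ) (e : Ent) : Ent :=
  ⟨Nat.xor e.m p, Nat.succ e.t, p :: appL e.l (xorL p e.l)⟩

noncomputable def ext (p : ℕ) (es : List Ent) : List Ent :=
  List.rec [] (fun e _ ih => extE p e :: ih) es

noncomputable def filterC (es : List Ent) (base : ℕ) (cs : CL) : CL :=
  CL.rec .nil (fun p v _ ih =>
    Nat.rec
      (Nat.rec ih (fun w _ => .cons p (Nat.succ w) ih) (addAll es p base v))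
      (fun _ _ => ih) (Nat.land (Nat.add base v) 2518595457530477447304)) cs

noncomputable def eqL (l : List ℕ) : List ℕ → Bool :=
  List.rec (motive := fun _ => List ℕ → Bool)
    (fun l' => List.rec true (fun _ _ _ => false) l')
    (fun a _ ih l' => List.rec false (fun b tl _ => sel (Nat.beq a b) (ih tl) false) l') l

noncomputable def memLL (l : List ℕ) (ls : List (List ℕ)) : Bool :=
  List.rec false (fun a _ ih => sel (eqL l a) true ih) ls

def sols : List (List ℕ) :=
  [[38997607048023524769792, 1162219258676257, 1082401, 1082400, 33],
   [37191016243003392, 1162219257593856, 1082401, 1082400, 33],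
   [1190112519776108544, 37191016243003392, 1082401, 1082400, 33],
   [38083600632835473408, 1190112519776108544, 1082401, 1082400, 33],
   [1218675220250735149056, 38083600632835473408, 1082401, 1082400, 33],
   [38997607048023524769792, 1218675220250735149056, 1082401, 1082400, 33]]

noncomputable def leafOK (S : List ℕ) (base : ℕ) : Bool :=
  sel (Nat.beq base 2203771025339167765845) (memLL S sols) true

noncomputable def go (r : ℕ) : List ℕ → List Ent → ℕ → CL → Bool :=
  Nat.rec (fun S _ base _ => leafOK S base)
    (fun _ ih S all base cs =>
      sel (leafOK S base)
        (CL.rec true (fun p v tl ihl =>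
          sel ((fun nw => (fun b2 => ih (p :: S) (appL all nw) b2 (filterC nw b2 tl))
            (Nat.add base v)) (ext p all)) ihl false) cs)
        false) r

noncomputable def memN (p : ℕ) (l : List ℕ) : Bool :=
  List.rec false (fun a _ ih => sel (Nat.beq p a) true ih) l

/-- initial candidates -/
noncomputable def mkC (S : List ℕ) (all : List Ent) (base : ℕ) (ch : List ℕ) : CL :=
  List.rec .nil (fun p _ ih =>
    sel (memN p S) ih
      (Nat.rec ih (fun w _ => .cons p (Nat.succ w) ih) (addAll all p base 0))) ch

def chordMask (a b : ℕ) : ℕ := Nat.div (Nat.sub (Nat.pow 32 b) (Nat.pow 32 a)) 31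

def allCh : List ℕ := [33, 1057, 33825, 1082401, 34636833, 1108378657, 35468117025, 1134979744801, 36319351833633, 1162219258676257, 37191016277640225, 1190112520884487201, 38083600668303590433, 1218675221385714893857, 1056, 33824, 1082400, 34636832, 1108378656, 35468117024, 1134979744800, 36319351833632, 1162219258676256, 37191016277640224, 1190112520884487200, 38083600668303590432, 1218675221385714893856, 38997607084342876603424, 33792, 1082368, 34636800, 1108378624, 35468116992, 1134979744768, 36319351833600, 1162219258676224, 37191016277640192, 1190112520884487168, 38083600668303590400, 1218675221385714893824, 38997607084342876603392, 1081344, 34635776, 1108377600, 35468115968, 1134979743744, 36319351832576, 1162219258675200, 37191016277639168, 1190112520884486144, 38083600668303589376, 1218675221385714892800, 38997607084342876602368, 34603008, 1108344832, 35468083200, 1134979710976, 36319351799808, 1162219258642432, 37191016277606400, 1190112520884453376, 38083600668303556608, 1218675221385714860032, 38997607084342876569600, 1107296256, 35467034624, 1134978662400, 36319350751232, 1162219257593856, 37191016276557824, 1190112520883404800, 38083600668302508032, 1218675221385713811456, 38997607084342875521024, 35433480192, 1134945107968, 36319317196800, 1162219224039424, 37191016243003392, 1190112520849850368, 38083600668268953600,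 1218675221385680257024, 38997607084342841966592, 1133871366144, 36318243454976, 1162218150297600, 37191015169261568, 1190112519776108544, 38083600667195211776, 1218675221384606515200, 38997607084341768224768, 36283883716608, 1162183790559232, 37190980809523200, 1190112485416370176, 38083600632835473408, 1218675221350246776832, 38997607084307408486400, 1161084278931456, 37189881297895424, 1190111385904742400, 38083599533323845632, 1218675220250735149056, 38997607083207896858624, 37154696925806592, 1190076201532653568, 38083564348951756800, 1218675185066363060224, 38997607048023524769792, 1188950301625810944, 38082438449044914176, 1218674059166456217600, 38997605922123617927168, 38046409652025950208, 1218638030369437253632, 38997569893326598963200, 1217485108864830406656, 38996416971821992116224, 38959523483674573012992]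

noncomputable def start (U : List ℕ) : ℕ → List ℕ → List Ent → ℕ → Bool :=
  List.rec (fun r S all base => go r S all base (mkC S all base allCh))
    (fun p _ ih r S all base =>
      sel (memN p S) (ih r S all base)
        (Nat.rec true
          (fun r' _ => Nat.rec true
            (fun w _ => ih r' (p :: S) (appL all (ext p all)) (Nat.add base (Nat.succ w)))
            (addAll all p base 0)) r)) U

noncomputable def root (U : List ℕ) : Bool :=
  start U 5 [] [⟨0, 0, []⟩] 1869270066135901230421

noncomputable def isHp (a b : ℕ) : Bool :=
  sel (Nat.beq b (Nat.succ a)) true (sel (Nat.beq a 0) (Nat.beq b 16) false)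

noncomputable def edg (a b : ℕ) (l : List ℕ) : List ℕ :=
  sel (isHp a b) l (chordMask a b :: l)

noncomputable def tri (x y z : ℕ) (l : List ℕ) : List ℕ :=
  edg x y (edg y z (edg x z l))

noncomputable def lenL (l : List ℕ) : ℕ := List.rec 0 (fun _ _ ih => Nat.succ ih) l

/-- lexicographic test that the sorted triple is not larger than its reflection under `x ↦ 2 - x` -/
noncomputable def lexLe (a b c x y z : ℕ) : Bool :=
  sel (Nat.blt a x) true (sel (Nat.beq a x)
    (sel (Nat.blt b y) true (sel (Nat.beq b y) (Nat.ble c z) false)) false)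

/-- `x ↦ 2 - x` modulo `17` -/
noncomputable def rfl2 (x : ℕ) : ℕ := Nat.mod (Nat.sub 19 x) 17

/-- sort and compare -/
noncomputable def lexR (x y z : ℕ) : Bool :=
  sel (Nat.blt 2 x) (lexLe x y z (rfl2 z) (rfl2 y) (rfl2 x))
   (sel (Nat.blt 2 y) (lexLe x y z (rfl2 x) (rfl2 z) (rfl2 y))
    (sel (Nat.blt 2 z) (lexLe x y z (rfl2 y) (rfl2 x) (rfl2 z))
     true))

noncomputable def skip (a b x y z : ℕ) : Bool :=
  sel (Nat.blt (lenL (tri x y z [])) (lenL (tri 0 a b []))) true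
    (sel (sel (Nat.beq x 0) (sel (Nat.beq y a) (Nat.beq z b) false) false) true
      (sel (Nat.beq b 2) (sel (lexR x y z) false true) false))

noncomputable def chk (a b x y z : ℕ) : Bool :=
  sel (skip a b x y z) true (root (tri 0 a b (tri x y z [])))

noncomputable def forLt (n : ℕ) (f : ℕ → Bool) : Bool :=
  Nat.rec true (fun i ih => sel (f i) ih false) n

noncomputable def chkZ (a b z : ℕ) : Bool :=
  forLt z (fun y => forLt y (fun x => chk a b x y z))


/-! ### Soundness of the search -/

section Soundness

lemma okN_nil (N x : ℕ) : okN N [] x = x := rfl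
lemma okN_cons (N q x : ℕ) (l : List ℕ) :
    okN N (q :: l) x = if (q &&& N) % N = 0 then 0 else okN N l x := by
  show Nat.rec (motive := fun _ => ℕ) 0 (fun _ _ => okN N l x) ((q &&& N) % N) = _
  cases h : (q &&& N) % N <;> simp

lemma okN_eq (N x : ℕ) (l : List ℕ) :
    okN N l x = if ∀ q ∈ l, (q &&& N) % N ≠ 0 then x else 0 := by
  induction l with
  | nil => simp [okN_nil]
  | cons q l ih =>
    rw [okN_cons, ih]
    by_cases h : (q &&& N) % N = 0 <;> simp [h]

lemma addAll_nil (p base v : ℕ) : addAll [] p base v = v := rfl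
lemma addAll_cons (e : Ent) (es : List Ent) (p base v : ℕ) :
    addAll (e :: es) p base v =
      if (base + (v + contrib p e)) &&& 2518595457530477447304 = 0
      then addAll es p base (v + contrib p e) else 0 := by
  show Nat.rec (motive := fun _ => ℕ) (addAll es p base (v + contrib p e)) (fun _ _ => 0)
    ((base + (v + contrib p e)) &&& 2518595457530477447304) = _
  cases h : ((base + (v + contrib p e)) &&& 2518595457530477447304) <;> simp

lemma xorL_eq (p : ℕ) (l : List ℕ) : xorL p l = l.map (fun q => q ^^^ p) := by
  induction l with
  | nil => rfl
  | cons q l ih => rw [List.map_cons, ← ih]; rfl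

lemma appL_eq {α : Type} (l l' : List α) : appL l l' = l ++ l' := by
  induction l with
  | nil => rfl
  | cons q l ih => rw [List.cons_append, ← ih]; rfl

lemma ext_eq (p : ℕ) (es : List Ent) : ext p es = es.map (extE p) := by
  induction es with
  | nil => rfl
  | cons q l ih => rw [List.map_cons, ← ih]; rfl

lemma sel_eq {α : Type} (b : Bool) (x y : α) : sel b x y = if b = true then x else y := by
  cases b <;> rfl

lemma memN_iff (p : ℕ) (l : List ℕ) : memN p l = true ↔ p ∈ l := by
  induction l with
  | nil => simp [memN]
  | cons q l ih =>
    have : memN p (q :: l) = sel (Nat.beq p q) true (memN p l) := rfl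
    rw [this, sel_eq]
    by_cases h : p = q
    · simp [h]
    · have : Nat.beq p q = false := by
        cases h2 : Nat.beq p q
        · rfl
        · exact absurd (Nat.eq_of_beq_eq_true h2) h
      simp [this, ih, h]

lemma eqL_imp : ∀ (l l' : List ℕ), eqL l l' = true → l = l'
  | [], [], _ => rfl
  | [], _ :: _, h => by simp [eqL] at h
  | _ :: _, [], h => by simp [eqL] at h
  | a :: l, b :: l', h => by
    have h' : sel (Nat.beq a b) (eqL l l') false = true := h
    rw [sel_eq] at h'
    split_ifs at h' with h1
    rw [Nat.eq_of_beq_eq_true h1, eqL_imp l l' h']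

lemma memLL_imp (l : List ℕ) (ls : List (List ℕ)) (h : memLL l ls = true) : l ∈ ls := by
  induction ls with
  | nil => simp [memLL] at h
  | cons a ls ih =>
    have h' : sel (eqL l a) true (memLL l ls) = true := h
    rw [sel_eq] at h'
    split_ifs at h' with h1
    · rw [eqL_imp l a h1]; simp
    · exact List.mem_cons_of_mem _ (ih h')

/-- The list of pairs of a candidate list. -/
def CL.toL : CL → List (ℕ × ℕ)
  | .nil => []
  | .cons p v tl => (p, v) :: tl.toL

lemma filterC_cons (es : List Ent) (base p v : ℕ) (cs : CL) :
    filterC es base (.cons p v cs) =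
      if (base + v) &&& 2518595457530477447304 = 0 then
        (if addAll es p base v = 0 then filterC es base cs
          else .cons p (addAll es p base v) (filterC es base cs))
      else filterC es base cs := by
  show Nat.rec (motive := fun _ => CL)
    (Nat.rec (motive := fun _ => CL) (filterC es base cs)
      (fun w _ => .cons p (Nat.succ w) (filterC es base cs)) (addAll es p base v))
      (fun _ _ => filterC es base cs) ((base + v) &&& 2518595457530477447304) = _
  cases h : ((base + v) &&& 2518595457530477447304) with
  | zero => cases h2 : addAll es p base v <;> simp
  | succ n => simp

lemma mkC_cons (S : List ℕ) (all : List Ent) (base p : ℕ) (ch : List ℕ) :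
    mkC S all base (p :: ch) =
      if p ∈ S then mkC S all base ch else
        (if addAll all p base 0 = 0 then mkC S all base ch
          else .cons p (addAll all p base 0) (mkC S all base ch)) := by
  have : mkC S all base (p :: ch) = sel (memN p S) (mkC S all base ch)
      (Nat.rec (motive := fun _ => CL) (mkC S all base ch)
        (fun w _ => .cons p (Nat.succ w) (mkC S all base ch)) (addAll all p base 0)) := rfl
  rw [this, sel_eq]
  simp only [memN_iff]
  congr 1
  cases addAll all p base 0 <;> simp

/-- Value of a multiset of lengths. -/
def mval (M : Multiset ℕ) : ℕ := (M.map (fun k => 16 ^ k)).sum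

lemma mval_add (M N : Multiset ℕ) : mval (M + N) = mval M + mval N := by
  simp [mval]

def Good (M : Multiset ℕ) : Prop := (∀ k, M.count k ≤ 2) ∧ ∀ k ∈ M, k < 18

lemma Good.mono {M N : Multiset ℕ} (h : Good N) (hM : M ≤ N) : Good M :=
  ⟨fun k => (Multiset.count_le_of_le k hM).trans (h.1 k), fun k hk => h.2 k (Multiset.mem_of_le hM hk)⟩

lemma mval_eq_sum (M : Multiset ℕ) (h : ∀ k ∈ M, k < 18) :
    mval M = ∑ k ∈ Finset.range 18, M.count k * 16 ^ k := by
  unfold mval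
  rw [Finset.sum_multiset_map_count]
  simp only [smul_eq_mul]
  apply Finset.sum_subset
  · intro k hk
    exact Finset.mem_range.2 (h k (Multiset.mem_toFinset.1 hk))
  · intro k _ hk
    have : M.count k = 0 := by
      rw [Multiset.count_eq_zero]; simpa using hk
    simp [this]

lemma land_digits (n : ℕ) : ∀ d : ℕ → ℕ, (∀ k < n, d k < 8) →
    (∑ k ∈ Finset.range n, d k * 16 ^ k) &&& (∑ k ∈ Finset.range n, 8 * 16 ^ k) = 0 := by
  induction n with
  | zero => intro d _; simp
  | succ n ih =>
    intro d hd
    rw [Finset.sum_range_succ', Finset.sum_range_succ']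
    have e1 : ∑ k ∈ Finset.range n, d (k + 1) * 16 ^ (k + 1)
        = 16 * ∑ k ∈ Finset.range n, d (k + 1) * 16 ^ k := by
      rw [Finset.mul_sum]; exact Finset.sum_congr rfl fun k _ => by ring
    have e2 : ∑ k ∈ Finset.range n, 8 * 16 ^ (k + 1)
        = 16 * ∑ k ∈ Finset.range n, 8 * 16 ^ k := by
      rw [Finset.mul_sum]; exact Finset.sum_congr rfl fun k _ => by ring
    rw [e1, e2]
    have h0 := hd 0 (Nat.succ_pos _)
    have ih' := ih (fun k => d (k + 1)) (fun k hk => hd (k + 1) (by omega))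
    set x := ∑ k ∈ Finset.range n, d (k + 1) * 16 ^ k
    set y := ∑ k ∈ Finset.range n, 8 * 16 ^ k
    have h1 : ((16 * x + d 0 * 16 ^ 0) &&& (16 * y + 8 * 16 ^ 0)) / 2 ^ 4 = 0 := by
      rw [Nat.and_div_two_pow]
      have a1 : (16 * x + d 0 * 16 ^ 0) / 2 ^ 4 = x := by omega
      have a2 : (16 * y + 8 * 16 ^ 0) / 2 ^ 4 = y := by omega
      rw [a1, a2, ih']
    have h2 : ((16 * x + d 0 * 16 ^ 0) &&& (16 * y + 8 * 16 ^ 0)) % 2 ^ 4 = 0 := by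
      rw [Nat.and_mod_two_pow]
      have a1 : (16 * x + d 0 * 16 ^ 0) % 2 ^ 4 = d 0 := by omega
      have a2 : (16 * y + 8 * 16 ^ 0) % 2 ^ 4 = 8 := by omega
      rw [a1, a2]
      interval_cases d 0 <;> rfl
    omega

lemma Good.land {M : Multiset ℕ} (h : Good M) :
    (1574122160956548404565 + mval M) &&& 2518595457530477447304 = 0 := by
  have h1 : 1574122160956548404565 + mval M
      = ∑ k ∈ Finset.range 18, (M.count k + 5) * 16 ^ k := by
    rw [mval_eq_sum M h.2]
    simp only [add_mul, Finset.sum_add_distrib]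
    rw [add_comm]
    congr 1
  have h2 : (2518595457530477447304 : ℕ) = ∑ k ∈ Finset.range 18, 8 * 16 ^ k := rfl
  rw [h1, h2]
  apply land_digits
  intro k _
  have := h.1 k
  omega

/-- xor of a set of masks -/
def PX (T : Finset ℕ) : ℕ := T.fold (fun a b => a ^^^ b) 0 id

lemma PX_empty : PX ∅ = 0 := rfl
lemma PX_insert {p : ℕ} {T : Finset ℕ} (h : p ∉ T) : PX (insert p T) = p ^^^ PX T := by
  unfold PX; rw [Finset.fold_insert h]; rfl

def IsEnt (e : Ent) (T : Finset ℕ) : Prop :=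
  e.m = PX T ∧ e.t = T.card ∧ ∀ q, q ∈ e.l ↔ ∃ T' ⊆ T, T'.Nonempty ∧ PX T' = q

/-- the search hypotheses -/
structure Model (Sx : Finset ℕ) (L : Finset ℕ → Multiset ℕ) : Prop where
  empty : L ∅ = {17}
  step : ∀ T ⊆ Sx, ∀ p ∈ Sx, p ∉ T → ∀ e, IsEnt e T → contrib p e = mval (L (insert p T))
  count : ∀ k, 3 ≤ k → k ≤ 17 → (∑ T ∈ Sx.powerset, L T).count k = 2
  mem : ∀ k ∈ (∑ T ∈ Sx.powerset, L T), 3 ≤ k ∧ k ≤ 17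
  ch : ∀ p ∈ Sx, p ∈ allCh

variable {Sx : Finset ℕ} {L : Finset ℕ → Multiset ℕ}

def tot (L : Finset ℕ → Multiset ℕ) (Ts : List (Finset ℕ)) : Multiset ℕ := (Ts.map L).sum

lemma tot_nil : tot L [] = 0 := rfl
lemma tot_cons (T : Finset ℕ) (Ts : List (Finset ℕ)) : tot L (T :: Ts) = L T + tot L Ts := by
  simp [tot]
lemma tot_append (T1 T2 : List (Finset ℕ)) : tot L (T1 ++ T2) = tot L T1 + tot L T2 := by
  simp [tot]

lemma tot_toFinset {Ts : List (Finset ℕ)} (h : Ts.Nodup) : tot L Ts = ∑ T ∈ Ts.toFinset, L T := by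
  rw [List.sum_toFinset _ h]; rfl

lemma Model.good (hm : Model Sx L) : Good (∑ T ∈ Sx.powerset, L T) := by
  constructor
  · intro k
    by_cases hk : k ∈ (∑ T ∈ Sx.powerset, L T)
    · have := hm.mem k hk
      exact (hm.count k this.1 this.2).le
    · rw [Multiset.count_eq_zero.2 hk]; omega
  · intro k hk
    have := hm.mem k hk
    omega

lemma Model.good_tot (hm : Model Sx L) {Ts : List (Finset ℕ)} (h : Ts.Nodup)
    (hs : ∀ T ∈ Ts, T ⊆ Sx) : Good (tot L Ts) := by
  apply hm.good.mono
  rw [tot_toFinset h]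
  apply Finset.sum_le_sum_of_subset
  intro T hT
  exact Finset.mem_powerset.2 (hs T (by simpa using hT))

def subs : List ℕ → List (Finset ℕ)
  | [] => [∅]
  | p :: S => subs S ++ (subs S).map (fun T => insert p T)

lemma mem_subs (S : List ℕ) : ∀ T, T ∈ subs S ↔ T ⊆ S.toFinset := by
  induction S with
  | nil => intro T; simp [subs]
  | cons p S ih =>
    intro T
    simp only [subs, List.mem_append, List.mem_map, ih, List.toFinset_cons]
    constructor
    · rintro (h | ⟨T', h, rfl⟩)
      · exact h.trans (Finset.subset_insert _ _)
      · exact Finset.insert_subset_insert _ h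
    · intro h
      by_cases hp : p ∈ T
      · right
        refine ⟨T.erase p, ?_, Finset.insert_erase hp⟩
        rw [Finset.subset_insert_iff] at h
        exact h
      · left
        rwa [Finset.subset_insert_iff_of_notMem hp] at h

lemma subs_nodup {S : List ℕ} (h : S.Nodup) : (subs S).Nodup := by
  induction S with
  | nil => simp [subs]
  | cons p S ih =>
    have hp := (List.nodup_cons.1 h).1
    have ih := ih (List.nodup_cons.1 h).2
    have hnot : ∀ T ∈ subs S, p ∉ T := fun T hT hpT =>
      hp (by simpa using (mem_subs S T).1 hT hpT)
    refine List.Nodup.append ih ?_ ?_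
    · refine (List.nodup_map_iff_inj_on ih).2 ?_
      intro T hT T' hT' hEq
      rw [← Finset.erase_insert (hnot T hT), ← Finset.erase_insert (hnot T' hT'), hEq]
    · intro T hT hT'
      obtain ⟨T', _, rfl⟩ := List.mem_map.1 hT'
      exact hnot _ hT (Finset.mem_insert_self _ _)

lemma extE_isEnt {p : ℕ} {e : Ent} {T : Finset ℕ} (hp : p ∉ T) (h : IsEnt e T) :
    IsEnt (extE p e) (insert p T) := by
  obtain ⟨h1, h2, h3⟩ := h
  refine ⟨?_, ?_, ?_⟩
  · show e.m ^^^ p = _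
    rw [PX_insert hp, h1, Nat.xor_comm]
  · show e.t + 1 = _
    rw [Finset.card_insert_of_notMem hp, h2]
  · intro q
    show q ∈ p :: appL e.l (xorL p e.l) ↔ _
    rw [appL_eq, xorL_eq]
    simp only [List.mem_cons, List.mem_append, List.mem_map, h3]
    constructor
    · rintro (rfl | ⟨T', hT', hn, rfl⟩ | ⟨q', ⟨T', hT', hn, rfl⟩, rfl⟩)
      · refine ⟨{q}, by simp, by simp, ?_⟩
        have : ({q} : Finset ℕ) = insert q ∅ := rfl
        rw [this, PX_insert (by simp), PX_empty, Nat.xor_zero]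
      · exact ⟨T', hT'.trans (Finset.subset_insert _ _), hn, rfl⟩
      · refine ⟨insert p T', Finset.insert_subset_insert _ hT', by simp, ?_⟩
        rw [PX_insert (fun h => hp (hT' h)), Nat.xor_comm]
    · rintro ⟨T', hT', hn, rfl⟩
      by_cases hpT : p ∈ T'
      · by_cases hE : (T'.erase p).Nonempty
        · right; right
          refine ⟨_, ⟨T'.erase p, ?_, hE, rfl⟩, ?_⟩
          · rwa [Finset.subset_insert_iff] at hT'
          · conv_rhs => rw [← Finset.insert_erase hpT]
            rw [PX_insert (Finset.notMem_erase _ _), Nat.xor_comm]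
        · left
          rw [Finset.not_nonempty_iff_eq_empty] at hE
          conv_lhs => rw [← Finset.insert_erase hpT, hE]
          rw [PX_insert (by simp), PX_empty, Nat.xor_zero]
      · right; left
        exact ⟨T', by rwa [Finset.subset_insert_iff_of_notMem hpT] at hT', hn, rfl⟩

/-- entries spec -/
def EntS (es : List Ent) (Ts : List (Finset ℕ)) : Prop := List.Forall₂ IsEnt es Ts

lemma entS_ext {es : List Ent} {Ts : List (Finset ℕ)} {p : ℕ} (h : EntS es Ts)
    (hp : ∀ T ∈ Ts, p ∉ T) : EntS (ext p es) (Ts.map (fun T => insert p T)) := by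
  rw [ext_eq]
  unfold EntS at *
  induction h with
  | nil => simp
  | cons h1 h2 ih =>
    simp only [List.map_cons]
    refine List.Forall₂.cons (extE_isEnt (hp _ (by simp)) h1) (ih ?_)
    intro T hT; exact hp T (by simp [hT])

lemma addAll_spec (hm : Model Sx L) {es : List Ent} {Ts : List (Finset ℕ)} (h : EntS es Ts)
    {p : ℕ} (hpS : p ∈ Sx) (B : Multiset ℕ) : ∀ W : Multiset ℕ,
    (∀ T ∈ Ts, T ⊆ Sx ∧ p ∉ T) → Good (B + (W + tot L (Ts.map (fun T => insert p T)))) →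
    addAll es p (1574122160956548404565 + mval B) (mval W)
      = mval (W + tot L (Ts.map (fun T => insert p T))) := by
  unfold EntS at h
  induction h with
  | nil => intro W _ _; simp [addAll_nil, tot_nil]
  | @cons e T es Ts h1 h2 ih =>
    intro W hT hg
    have hT0 := hT T (by simp)
    have hc := hm.step T hT0.1 p hpS hT0.2 e h1
    rw [addAll_cons, hc, ← mval_add, add_assoc, ← mval_add]
    rw [List.map_cons, tot_cons] at hg ⊢
    have hle : B + (W + L (insert p T)) ≤
        B + (W + (L (insert p T) + tot L (Ts.map (fun T => insert p T)))) := by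
      rw [← add_assoc W]
      exact add_le_add le_rfl (Multiset.le_add_right _ _)
    rw [if_pos (hg.mono hle).land, ih]
    · rw [add_assoc]
    · intro T' hT'; exact hT T' (by simp [hT'])
    · rwa [add_assoc W]

/-- value spec -/
def VS (L : Finset ℕ → Multiset ℕ) (S : List ℕ) (p : ℕ) : ℕ :=
  mval (tot L ((subs S).map (fun T => insert p T)))

lemma mval_pos (hm : Model Sx L) {p : ℕ} (hp : p ∈ Sx) {S : List ℕ} :
    VS L S p ≠ 0 := by
  unfold VS
  have h1 : 0 < mval (L (insert p ∅)) := by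
    rw [← hm.step ∅ (by simp) p hp (by simp) ⟨0, 0, []⟩ ?_]
    · show 0 < 16 ^ _ + 16 ^ _
      positivity
    · refine ⟨rfl, rfl, ?_⟩
      intro q
      simp only [List.not_mem_nil, false_iff]
      rintro ⟨T', h, hn, _⟩
      rw [Finset.subset_empty] at h
      simp [h] at hn
  have h2 : insert p ∅ ∈ (subs S).map (fun T => insert p T) :=
    List.mem_map.2 ⟨∅, (mem_subs S ∅).2 (by simp), rfl⟩
  obtain ⟨l1, l2, hl⟩ := List.append_of_mem h2
  rw [hl, tot_append, tot_cons, mval_add, mval_add]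
  omega

def baseS (L : Finset ℕ → Multiset ℕ) (S : List ℕ) : ℕ := 1574122160956548404565 + mval (tot L (subs S))

lemma baseS_cons (S : List ℕ) (p : ℕ) : baseS L (p :: S) = baseS L S + VS L S p := by
  simp only [baseS, VS, subs, tot_append, mval_add, add_assoc]

lemma VS_cons (S : List ℕ) (p q : ℕ) : VS L (q :: S) p = mval (tot L ((subs S).map (fun T => insert p T))
    + tot L (((subs S).map (fun T => insert q T)).map (fun T => insert p T))) := by
  rw [VS, subs, List.map_append, tot_append]

lemma good_base_add (hm : Model Sx L) {S : List ℕ} (hS : S.Nodup) (hSx : S.toFinset ⊆ Sx) {p : ℕ}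
    (hp : p ∈ Sx) (hpS : p ∉ S) :
    Good (tot L (subs S) + tot L ((subs S).map (fun T => insert p T))) := by
  rw [← tot_append]
  apply hm.good_tot (Ts := subs (p :: S)) (subs_nodup (List.nodup_cons.2 ⟨hpS, hS⟩))
  intro T hT
  refine ((mem_subs _ T).1 hT).trans ?_
  rw [List.toFinset_cons]
  exact Finset.insert_subset hp hSx

lemma addAll_full (hm : Model Sx L) {S : List ℕ} (hS : S.Nodup) (hSx : S.toFinset ⊆ Sx) {p : ℕ}
    (hp : p ∈ Sx) (hpS : p ∉ S) {all : List Ent} (hall : EntS all (subs S)) :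
    addAll all p (baseS L S) 0 = VS L S p := by
  have := addAll_spec hm hall hp (tot L (subs S)) 0 ?_ ?_
  · simpa [mval, baseS, VS] using this
  · intro T hT
    have hT := (mem_subs _ T).1 hT
    exact ⟨hT.trans hSx, fun h => hpS (by simpa using hT h)⟩
  · rw [zero_add]
    exact good_base_add hm hS hSx hp hpS

lemma addAll_new (hm : Model Sx L) {S : List ℕ} {q : ℕ} (hS : (q :: S).Nodup)
    (hSx : (q :: S).toFinset ⊆ Sx) {p : ℕ}
    (hp : p ∈ Sx) (hpS : p ∉ q :: S) {all : List Ent}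
    (hall : EntS all ((subs S).map (fun T => insert q T))) :
    addAll all p (baseS L (q :: S)) (VS L S p) = VS L (q :: S) p := by
  rw [VS_cons]
  refine addAll_spec hm hall hp (tot L (subs (q :: S))) _ ?_ ?_
  · intro T hT
    have hT : T ∈ subs (q :: S) := by rw [subs]; exact List.mem_append_right _ hT
    have hT := (mem_subs _ T).1 hT
    refine ⟨hT.trans hSx, fun h => hpS ?_⟩
    exact List.mem_toFinset.1 (hT h)
  · have := good_base_add hm hS hSx hp hpS
    rwa [show subs (q :: S) = subs S ++ (subs S).map (fun T => insert q T) from rfl,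
      List.map_append, tot_append _ (List.map _ (List.map _ _))] at this

/-- candidate invariant -/
def InvC (Sx : Finset ℕ) (L : Finset ℕ → Multiset ℕ) (S : List ℕ) (cs : CL) : Prop :=
  (∀ p ∈ Sx, p ∉ S → ∃ v, (p, v) ∈ cs.toL) ∧
  (∀ p v, (p, v) ∈ cs.toL → p ∈ Sx → p ∉ S → v = VS L S p)

lemma mkC_spec (hm : Model Sx L) {S : List ℕ} (hS : S.Nodup) (hSx : S.toFinset ⊆ Sx)
    {all : List Ent} (hall : EntS all (subs S)) (ch : List ℕ) :
    (∀ p ∈ Sx, p ∉ S → p ∈ ch → ∃ v, (p, v) ∈ (mkC S all (baseS L S) ch).toL) ∧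
    (∀ p v, (p, v) ∈ (mkC S all (baseS L S) ch).toL → p ∈ Sx → p ∉ S → v = VS L S p) := by
  induction ch with
  | nil =>
    constructor
    · intro p _ _ h; simp at h
    · intro p v h
      have : mkC S all (baseS L S) [] = .nil := rfl
      rw [this] at h; simp [CL.toL] at h
  | cons c ch ih =>
    rw [mkC_cons]
    by_cases hc : c ∈ S
    · rw [if_pos hc]
      refine ⟨?_, ih.2⟩
      intro p hp hpS hpc
      rcases List.mem_cons.1 hpc with rfl | h
      · exact absurd hc hpS
      · exact ih.1 p hp hpS h
    · rw [if_neg hc]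
      by_cases hcx : c ∈ Sx
      · have hv := addAll_full hm hS hSx hcx hc hall
        rw [hv, if_neg (mval_pos hm hcx)]
        constructor
        · intro p hp hpS hpc
          rcases List.mem_cons.1 hpc with rfl | h
          · exact ⟨VS L S p, by simp [CL.toL]⟩
          · obtain ⟨v, hv⟩ := ih.1 p hp hpS h
            exact ⟨v, by simp [CL.toL, hv]⟩
        · intro p v h hp hpS
          simp only [CL.toL, List.mem_cons, Prod.mk.injEq] at h
          rcases h with ⟨rfl, rfl⟩ | h
          · rfl
          · exact ih.2 p v h hp hpS
      · have h1 : ∀ p ∈ Sx, p ∉ S → p ∈ c :: ch → ∃ v, (p, v) ∈ (mkC S all (baseS L S) ch).toL := by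
          intro p hp hpS hpc
          rcases List.mem_cons.1 hpc with rfl | h
          · exact absurd hp hcx
          · exact ih.1 p hp hpS h
        split_ifs
        · exact ⟨h1, ih.2⟩
        · constructor
          · intro p hp hpS hpc
            obtain ⟨v, hv⟩ := h1 p hp hpS hpc
            exact ⟨v, by simp [CL.toL, hv]⟩
          · intro p v h hp hpS
            simp only [CL.toL, List.mem_cons, Prod.mk.injEq] at h
            rcases h with ⟨rfl, rfl⟩ | h
            · exact absurd hp hcx
            · exact ih.2 p v h hp hpS

lemma filterC_spec (hm : Model Sx L) {S : List ℕ} {q : ℕ} (hS : (q :: S).Nodup)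
    (hSx : (q :: S).toFinset ⊆ Sx) {nw : List Ent}
    (hall : EntS nw ((subs S).map (fun T => insert q T))) (cs : CL)
    (hcs : ∀ p v, (p, v) ∈ cs.toL → p ∈ Sx → p ∉ S → v = VS L S p) :
    (∀ p ∈ Sx, p ∉ q :: S → (∃ v, (p, v) ∈ cs.toL) →
      ∃ v, (p, v) ∈ (filterC nw (baseS L (q :: S)) cs).toL) ∧
    (∀ p v, (p, v) ∈ (filterC nw (baseS L (q :: S)) cs).toL → p ∈ Sx → p ∉ q :: S →
      v = VS L (q :: S) p) := by
  induction cs with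
  | nil =>
    constructor
    · intro p _ _ h; simp [CL.toL] at h
    · intro p v h
      have : filterC nw (baseS L (q :: S)) .nil = .nil := rfl
      rw [this] at h; simp [CL.toL] at h
  | cons c v cs ih =>
    have ih := ih (fun p v h => hcs p v (by simp [CL.toL, h]))
    rw [filterC_cons]
    by_cases hc : c ∈ Sx ∧ c ∉ q :: S
    · obtain ⟨hcx, hcS⟩ := hc
      have hv : v = VS L S c := hcs c v (by simp [CL.toL]) hcx (fun h => hcS (by simp [h]))
      have hadd := addAll_new hm hS hSx hcx hcS hall
      have hg : (baseS L (q :: S) + v) &&& 2518595457530477447304 = 0 := by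
        rw [hv, baseS, VS, add_assoc, ← mval_add]
        refine (good_base_add hm hS hSx hcx hcS |>.mono ?_).land
        rw [show subs (q :: S) = subs S ++ (subs S).map (fun T => insert q T) from rfl,
          List.map_append, tot_append _ (List.map _ (List.map _ _))]
        exact add_le_add le_rfl (Multiset.le_add_right _ _)
      rw [if_pos hg, hv, hadd, if_neg (mval_pos hm hcx)]
      constructor
      · rintro p hp hpS ⟨v', hv'⟩
        simp only [CL.toL, List.mem_cons, Prod.mk.injEq] at hv'
        rcases hv' with ⟨rfl, rfl⟩ | h
        · exact ⟨_, by simp only [CL.toL]; exact List.mem_cons_self⟩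
        · obtain ⟨v, hv⟩ := ih.1 p hp hpS ⟨v', h⟩
          exact ⟨v, by simp [CL.toL, hv]⟩
      · intro p v h hp hpS
        simp only [CL.toL, List.mem_cons, Prod.mk.injEq] at h
        rcases h with ⟨rfl, rfl⟩ | h
        · rfl
        · exact ih.2 p v h hp hpS
    · have h1 : ∀ p ∈ Sx, p ∉ q :: S → (∃ v', (p, v') ∈ (CL.cons c v cs).toL) →
          ∃ v, (p, v) ∈ (filterC nw (baseS L (q :: S)) cs).toL := by
        rintro p hp hpS ⟨v', hv'⟩
        simp only [CL.toL, List.mem_cons, Prod.mk.injEq] at hv'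
        rcases hv' with ⟨rfl, rfl⟩ | h
        · exact absurd ⟨hp, hpS⟩ hc
        · exact ih.1 p hp hpS ⟨v', h⟩
      split_ifs
      · exact ⟨h1, ih.2⟩
      · constructor
        · intro p hp hpS hpc
          obtain ⟨v, hv⟩ := h1 p hp hpS hpc
          exact ⟨v, by simp [CL.toL, hv]⟩
        · intro p v h hp hpS
          simp only [CL.toL, List.mem_cons, Prod.mk.injEq] at h
          rcases h with ⟨rfl, rfl⟩ | h
          · exact absurd ⟨hp, hpS⟩ hc
          · exact ih.2 p v h hp hpS
      · exact ⟨h1, ih.2⟩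

lemma leaf_spec (hm : Model Sx L) {S : List ℕ} (hS : S.Nodup) (hSx : S.toFinset = Sx)
    (h : leafOK S (baseS L S) = true) : ∃ s ∈ sols, s.toFinset = Sx := by
  have hb : baseS L S = 2203771025339167765845 := by
    have e : tot L (subs S) = ∑ T ∈ Sx.powerset, L T := by
      rw [tot_toFinset (subs_nodup hS)]
      apply Finset.sum_congr _ (fun _ _ => rfl)
      ext T
      rw [List.mem_toFinset, mem_subs, hSx, Finset.mem_powerset]
    rw [baseS, e, mval_eq_sum _ hm.good.2]
    have : ∀ k ∈ Finset.range 18, (∑ T ∈ Sx.powerset, L T).count k * 16 ^ k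
        = (if k < 3 then 0 else 2) * 16 ^ k := by
      intro k hk
      congr 1
      split_ifs with h3
      · rw [Multiset.count_eq_zero]
        intro hk'
        have := hm.mem k hk'
        omega
      · exact hm.count k (by omega) (by have := Finset.mem_range.1 hk; omega)
    rw [Finset.sum_congr rfl this]
    rfl
  have h' : sel (Nat.beq (baseS L S) 2203771025339167765845) (memLL S sols) true = true := h
  rw [sel_eq, hb] at h'
  rw [if_pos (Nat.beq_refl _)] at h'
  exact ⟨S, memLL_imp _ _ h', hSx⟩

noncomputable def loop (F : ℕ → ℕ → CL → Bool) (cs : CL) : Bool :=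
  CL.rec true (fun p v tl ihl => sel (F p v tl) ihl false) cs

lemma go_succ (r : ℕ) (S : List ℕ) (all : List Ent) (base : ℕ) (cs : CL) :
    go (r + 1) S all base cs = sel (leafOK S base)
      (loop (fun p v tl => go r (p :: S) (appL all (ext p all)) (base + v)
        (filterC (ext p all) (base + v) tl)) cs) false := rfl

lemma go_spec (hm : Model Sx L) (r : ℕ) : ∀ (S : List ℕ) (all : List Ent) (cs : CL),
    S.Nodup → S.toFinset ⊆ Sx → EntS all (subs S) → InvC Sx L S cs → Sx.card ≤ r + S.length →
    go r S all (baseS L S) cs = true → ∃ s ∈ sols, s.toFinset = Sx := by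
  induction r with
  | zero =>
    intro S all cs hS hSx _ _ hr h
    refine leaf_spec hm hS (Finset.eq_of_subset_of_card_le hSx ?_) h
    rw [List.toFinset_card_of_nodup hS]; omega
  | succ r ih =>
    intro S all cs hS hSx hall hcs hr h
    rw [go_succ, sel_eq] at h
    split_ifs at h with hleaf
    by_cases hE : S.toFinset = Sx
    · exact leaf_spec hm hS hE hleaf
    · obtain ⟨p0, hp0, hp0S⟩ : ∃ p ∈ Sx, p ∉ S := by
        by_contra hcon
        push Not at hcon
        apply hE
        refine hSx.antisymm ?_
        intro p hp
        simpa using hcon p hp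
      induction cs with
      | nil =>
        obtain ⟨v, hv⟩ := hcs.1 p0 hp0 hp0S
        simp [CL.toL] at hv
      | cons p v tl ihl =>
        have h' : sel (go r (p :: S) (appL all (ext p all)) (baseS L S + v)
          (filterC (ext p all) (baseS L S + v) tl)) (loop (fun p v tl => go r (p :: S)
          (appL all (ext p all)) (baseS L S + v)
          (filterC (ext p all) (baseS L S + v) tl)) tl) false = true := h
        rw [sel_eq] at h'
        split_ifs at h' with hgo
        by_cases hp : p ∈ Sx ∧ p ∉ S
        · obtain ⟨hp, hpS⟩ := hp
          have hv : v = VS L S p := hcs.2 p v (by simp [CL.toL]) hp hpS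
          rw [hv, ← baseS_cons] at hgo
          have hS' : (p :: S).Nodup := List.nodup_cons.2 ⟨hpS, hS⟩
          have hSx' : (p :: S).toFinset ⊆ Sx := by
            rw [List.toFinset_cons]; exact Finset.insert_subset hp hSx
          have hnw : EntS (ext p all) ((subs S).map (fun T => insert p T)) := by
            apply entS_ext hall
            intro T hT hpT
            exact hpS (by simpa using (mem_subs _ T).1 hT hpT)
          refine ih (p :: S) _ _ hS' hSx' ?_ ?_ ?_ hgo
          · rw [appL_eq]
            exact List.rel_append hall hnw
          · have hf := filterC_spec hm hS' hSx' hnw tl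
              (fun p' v' h => hcs.2 p' v' (by simp [CL.toL, h]))
            refine ⟨?_, hf.2⟩
            intro p' hp' hp'S
            apply hf.1 p' hp' hp'S
            obtain ⟨v', hv'⟩ := hcs.1 p' hp' (fun h => hp'S (by simp [h]))
            simp only [CL.toL, List.mem_cons, Prod.mk.injEq] at hv'
            rcases hv' with ⟨rfl, _⟩ | hv'
            · simp at hp'S
            · exact ⟨v', hv'⟩
          · rw [List.length_cons]; omega
        · apply ihl _ h'
          constructor
          · intro p' hp' hp'S
            obtain ⟨v', hv'⟩ := hcs.1 p' hp' hp'S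
            simp only [CL.toL, List.mem_cons, Prod.mk.injEq] at hv'
            rcases hv' with ⟨rfl, _⟩ | hv'
            · exact absurd ⟨hp', hp'S⟩ hp
            · exact ⟨v', hv'⟩
          · intro p' v' hv'
            exact hcs.2 p' v' (by simp [CL.toL, hv'])

lemma start_cons (p : ℕ) (U : List ℕ) (r : ℕ) (S : List ℕ) (all : List Ent) (base : ℕ) :
    start (p :: U) r S all base = if p ∈ S then start U r S all base else
      (match r with
        | 0 => true
        | r' + 1 => if addAll all p base 0 = 0 then true else
          start U r' (p :: S) (appL all (ext p all)) (base + addAll all p base 0)) := by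
  have : start (p :: U) r S all base = sel (memN p S) (start U r S all base)
        (Nat.rec (motive := fun _ => Bool) true
          (fun r' _ => Nat.rec (motive := fun _ => Bool) true
            (fun w _ => start U r' (p :: S) (appL all (ext p all)) (Nat.add base (Nat.succ w)))
            (addAll all p base 0)) r) := rfl
  rw [this, sel_eq]
  simp only [memN_iff]
  congr 1
  cases r with
  | zero => rfl
  | succ r =>
    simp only
    cases addAll all p base 0 <;> simp

lemma start_spec (hm : Model Sx L) (U : List ℕ) : ∀ (r : ℕ) (S : List ℕ) (all : List Ent),
    (∀ p ∈ U, p ∈ Sx) →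
    S.Nodup → S.toFinset ⊆ Sx → EntS all (subs S) → Sx.card ≤ r + S.length →
    start U r S all (baseS L S) = true → ∃ s ∈ sols, s.toFinset = Sx := by
  induction U with
  | nil =>
    intro r S all _ hS hSx hall hr h
    have h' : go r S all (baseS L S) (mkC S all (baseS L S) allCh) = true := h
    refine go_spec hm r S all _ hS hSx hall ?_ hr h'
    have := mkC_spec hm hS hSx hall allCh
    exact ⟨fun p hp hpS => this.1 p hp hpS (hm.ch p hp), this.2⟩
  | cons p U ih =>
    intro r S all hU hS hSx hall hr h
    have hp := hU p (by simp)
    have hU' : ∀ p ∈ U, p ∈ Sx := fun q hq => hU q (by simp [hq])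
    rw [start_cons] at h
    by_cases hpS : p ∈ S
    · rw [if_pos hpS] at h
      exact ih r S all hU' hS hSx hall hr h
    · rw [if_neg hpS] at h
      have hS' : (p :: S).Nodup := List.nodup_cons.2 ⟨hpS, hS⟩
      have hSx' : (p :: S).toFinset ⊆ Sx := by
        rw [List.toFinset_cons]; exact Finset.insert_subset hp hSx
      have hnw : EntS (ext p all) ((subs S).map (fun T => insert p T)) := by
        apply entS_ext hall
        intro T hT hpT
        exact hpS (by simpa using (mem_subs _ T).1 hT hpT)
      cases r with
      | zero =>
        exfalso
        have := Finset.card_le_card hSx'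
        rw [List.toFinset_card_of_nodup hS', List.length_cons] at this
        omega
      | succ r =>
        simp only at h
        rw [addAll_full hm hS hSx hp hpS hall, if_neg (mval_pos hm hp), ← baseS_cons] at h
        refine ih r (p :: S) _ hU' hS' hSx' ?_ ?_ h
        · rw [appL_eq]
          exact List.rel_append hall hnw
        · rw [List.length_cons]; omega

lemma root_spec (hm : Model Sx L) (hc : Sx.card ≤ 5) (U : List ℕ) (hU : ∀ p ∈ U, p ∈ Sx)
    (h : root U = true) : ∃ s ∈ sols, s.toFinset = Sx := by
  have hb : (1869270066135901230421 : ℕ) = baseS L [] := by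
    simp [baseS, subs, tot, hm.empty, mval]
  unfold root at h
  rw [hb] at h
  refine start_spec hm U 5 [] _ hU (by simp) (by simp) ?_ (by simpa using hc) h
  refine List.Forall₂.cons ⟨rfl, rfl, ?_⟩ List.Forall₂.nil
  intro q
  simp only [List.not_mem_nil, false_iff]
  rintro ⟨T', h, hn, _⟩
  rw [Finset.subset_empty] at h
  simp [h] at hn

end Soundness


/-! ### Cycles as minimal even edge sets -/

section Cycles

variable {V : Type*} [DecidableEq V]

/-- parity of the degree of `v` in the edge set `E` -/
def par (E : Finset (Sym2 V)) (v : V) : ZMod 2 := ∑ e ∈ E, if v ∈ e then 1 else 0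

def EvenE (E : Finset (Sym2 V)) : Prop := ∀ v, par E v = 0

def MinEven (E : Finset (Sym2 V)) : Prop :=
  E.Nonempty ∧ EvenE E ∧ ∀ E' ⊆ E, E'.Nonempty → EvenE E' → E' = E

/-- edge set of the closed walk `f` -/
def cycE {n : ℕ} (f : Fin (n + 3) → V) : Finset (Sym2 V) :=
  Finset.univ.image (fun i => s(f i, f (i + 1)))

lemma fin_add_one_ne {n : ℕ} (i : Fin (n + 3)) : i + 1 ≠ i := by
  intro h
  have : (1 : Fin (n + 3)) = 0 := add_eq_left.1 h
  have h2 : 1 % (n + 3) = 0 := congrArg Fin.val this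
  rw [Nat.mod_eq_of_lt (by omega)] at h2
  omega

lemma fin_add_two_ne {n : ℕ} (i : Fin (n + 3)) : i + 1 + 1 ≠ i := by
  intro h
  have : (1 + 1 : Fin (n + 3)) = 0 := by rw [add_assoc] at h; simpa using h
  have h2 : (1 % (n + 3) + 1 % (n + 3)) % (n + 3) = 0 := congrArg Fin.val this
  rw [Nat.mod_eq_of_lt (show 1 < n + 3 by omega), Nat.mod_eq_of_lt (by omega)] at h2
  omega

lemma cyc_edge_inj {n : ℕ} {f : Fin (n + 3) → V} (hf : Function.Injective f) :
    Function.Injective (fun i => s(f i, f (i + 1))) := by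
  intro i j h
  simp only [Sym2.eq_iff] at h
  rcases h with ⟨h, _⟩ | ⟨h1, h2⟩
  · exact hf h
  · have h1 := hf h1
    have h2 := hf h2
    rw [h1] at h2
    exact absurd h2 (fin_add_two_ne j)

lemma cycE_card {n : ℕ} {f : Fin (n + 3) → V} (hf : Function.Injective f) :
    (cycE f).card = n + 3 := by
  rw [cycE, Finset.card_image_of_injective _ (cyc_edge_inj hf)]; simp

lemma mem_cyc_edge {n : ℕ} {f : Fin (n + 3) → V} (hf : Function.Injective f) (i j : Fin (n + 3)) :
    f i ∈ s(f j, f (j + 1)) ↔ j = i ∨ j = i - 1 := by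
  rw [Sym2.mem_iff]
  constructor
  · rintro (h | h)
    · exact Or.inl (hf h).symm
    · right; rw [hf h]; simp
  · rintro (rfl | rfl)
    · simp
    · simp

lemma fin_sub_one_ne {n : ℕ} (i : Fin (n + 3)) : i - 1 ≠ i := by
  intro h
  have := fin_add_one_ne (i - 1)
  rw [sub_add_cancel] at this
  exact this h.symm

lemma par_sub_cyc {n : ℕ} {f : Fin (n + 3) → V} (hf : Function.Injective f) {E : Finset (Sym2 V)}
    (hE : E ⊆ cycE f) (i : Fin (n + 3)) :
    par E (f i) = (if s(f i, f (i + 1)) ∈ E then 1 else 0) +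
      (if s(f (i - 1), f (i - 1 + 1)) ∈ E then 1 else 0) := by
  have h1 : par E (f i) = ∑ e ∈ cycE f, if e ∈ E ∧ f i ∈ e then 1 else 0 := by
    rw [par, ← Finset.sum_filter, ← Finset.sum_filter]
    apply Finset.sum_congr _ (fun _ _ => rfl)
    ext e
    simp only [Finset.mem_filter]
    exact ⟨fun h => ⟨hE h.1, h⟩, fun h => h.2⟩
  rw [h1, cycE, Finset.sum_image (fun a _ b _ h => cyc_edge_inj hf h)]
  simp only [mem_cyc_edge hf]
  rw [Finset.sum_eq_add_of_mem i (i - 1) (Finset.mem_univ _) (Finset.mem_univ _)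
    (fin_sub_one_ne i).symm]
  · simp
  · rintro j _ ⟨h1, h2⟩
    simp [h1, h2]

lemma par_not_cyc {n : ℕ} {f : Fin (n + 3) → V} {E : Finset (Sym2 V)}
    (hE : E ⊆ cycE f) (v : V) (hv : ∀ i, f i ≠ v) : par E v = 0 := by
  apply Finset.sum_eq_zero
  intro e he
  obtain ⟨i, _, rfl⟩ := Finset.mem_image.1 (hE he)
  rw [if_neg]
  rw [Sym2.mem_iff]
  rintro (h | h) <;> exact hv _ h.symm

lemma cycE_minEven {n : ℕ} {f : Fin (n + 3) → V} (hf : Function.Injective f) :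
    MinEven (cycE f) := by
  have hmem : ∀ i, s(f i, f (i + 1)) ∈ cycE f := fun i =>
    Finset.mem_image.2 ⟨i, Finset.mem_univ _, rfl⟩
  refine ⟨⟨_, hmem 0⟩, ?_, ?_⟩
  · intro v
    by_cases hv : ∃ i, f i = v
    · obtain ⟨i, rfl⟩ := hv
      rw [par_sub_cyc hf subset_rfl, if_pos (hmem _), if_pos (hmem _)]
      decide
    · push Not at hv
      exact par_not_cyc subset_rfl v hv
  · intro E hE ⟨e, he⟩ hev
    refine hE.antisymm ?_
    have hstep : ∀ i, s(f i, f (i + 1)) ∈ E → s(f (i + 1), f (i + 1 + 1)) ∈ E := by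
      intro i hi
      have := hev (f (i + 1))
      rw [par_sub_cyc hf hE, add_sub_cancel_right, if_pos hi] at this
      by_contra hcon
      rw [if_neg hcon] at this
      exact absurd this (by decide)
    obtain ⟨i, _, rfl⟩ := Finset.mem_image.1 (hE he)
    have hall : ∀ d : Fin (n + 2 + 1), s(f (i + d), f (i + d + 1)) ∈ E := by
      intro d
      induction d using Fin.induction with
      | zero => simpa using he
      | succ d ih =>
        have := hstep _ ih
        rw [add_assoc i, Fin.coeSucc_eq_succ] at this
        exact this
    intro e he
    obtain ⟨j, _, rfl⟩ := Finset.mem_image.1 he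
    have := hall (j - i)
    simpa using this

lemma exists_leaf {V : Type*} [Fintype V] {G : SimpleGraph V} (hG : G.IsAcyclic) {a b : V}
    (hab : G.Adj a b) : ∃ u w, G.Adj u w ∧ ∀ x, G.Adj u x → x = w := by
  classical
  have : Nonempty V := ⟨a⟩
  obtain ⟨u, v, p, hp, hmax⟩ := Walk.exists_isPath_forall_isPath_length_le_length G
  have hlen : 1 ≤ p.length := by
    have := hmax a b (Walk.cons hab Walk.nil) (by simp [hab.ne])
    simpa using this
  have hnn : ¬ p.Nil := by
    intro h
    rw [← Walk.length_eq_zero_iff] at h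
    omega
  refine ⟨u, p.snd, p.adj_snd hnn, ?_⟩
  intro x hx
  by_cases hxs : x ∈ p.support
  · exact hG.eq_snd_of_adj_start hp hx hxs
  · have := hmax _ _ (Walk.cons hx.symm p) (by rw [Walk.cons_isPath_iff]; exact ⟨hp, hxs⟩)
    simp at this

lemma even_not_acyclic [Fintype V] {E : Finset (Sym2 V)} (hE : EvenE E)
    (hd : ∀ e ∈ E, ¬ e.IsDiag) (hn : E.Nonempty) :
    ¬ (SimpleGraph.fromEdgeSet (E : Set (Sym2 V))).IsAcyclic := by
  intro hac
  obtain ⟨e, he⟩ := hn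
  induction e with | _ a b
  have hab : (SimpleGraph.fromEdgeSet (E : Set (Sym2 V))).Adj a b := by
    rw [SimpleGraph.fromEdgeSet_adj]
    exact ⟨he, by simpa using hd _ he⟩
  obtain ⟨u, w, huw, hu⟩ := exists_leaf hac hab
  have := hE u
  rw [par, Finset.sum_eq_single s(u, w)] at this
  · simp at this
  · intro e he hne
    rw [if_neg]
    intro hue
    obtain ⟨x, rfl⟩ := Sym2.mem_iff_exists.1 hue
    apply hne
    rw [hu x]
    rw [SimpleGraph.fromEdgeSet_adj]
    exact ⟨he, by simpa using hd _ he⟩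
  · intro h
    exact absurd (SimpleGraph.fromEdgeSet_adj _ |>.1 huw).1 h

lemma cyc_adj {n : ℕ} (i : Fin (n + 3)) : (cycleGraph (n + 3)).Adj i (i + 1) := by
  rw [cycleGraph_adj]; right; simp

lemma minEven_cyc [Fintype V] {E : Finset (Sym2 V)} (hE : MinEven E)
    (hd : ∀ e ∈ E, ¬ e.IsDiag) : ∃ n, ∃ f : Fin (n + 3) → V, Function.Injective f ∧ E = cycE f := by
  have h := even_not_acyclic hE.2.1 hd hE.1
  rw [isAcyclic_iff_free_cycleGraph] at h
  push Not at h
  obtain ⟨k, hk, hc⟩ := h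
  obtain ⟨n, rfl⟩ : ∃ n, k = n + 3 := ⟨k - 3, by omega⟩
  obtain ⟨⟨g, hg⟩⟩ := hc
  refine ⟨n, g, hg, ?_⟩
  symm
  apply hE.2.2 _ _ (cycE_minEven hg).1 (cycE_minEven hg).2.1
  intro e he
  obtain ⟨i, _, rfl⟩ := Finset.mem_image.1 he
  have := g.map_rel (cyc_adj i)
  exact (SimpleGraph.fromEdgeSet_adj _ |>.1 this).1

/-- subgraph spanned by `cycE f` -/
lemma subgraph_iso_iff {G : SimpleGraph V} {n : ℕ} (H : G.Subgraph) :
    Nonempty (H.coe ≃g cycleGraph (n + 3)) ↔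
      ∃ f : Fin (n + 3) → V, Function.Injective f ∧ H.verts = Set.range f ∧
        H.edgeSet = (cycE f : Set (Sym2 V)) := by
  constructor
  · rintro ⟨φ⟩
    refine ⟨fun i => (φ.symm i : V), ?_, ?_, ?_⟩
    · intro i j h
      exact φ.symm.injective (Subtype.ext h)
    · ext v
      constructor
      · intro hv
        exact ⟨φ ⟨v, hv⟩, by simp⟩
      · rintro ⟨i, rfl⟩
        exact (φ.symm i).2
    · ext e
      induction e with | _ a b
      simp only [Subgraph.mem_edgeSet, cycE, Finset.coe_image, Finset.coe_univ, Set.image_univ,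
        Set.mem_range]
      constructor
      · intro hab
        have ha := H.edge_vert hab
        have hb := H.edge_vert hab.symm
        have h1 : H.coe.Adj ⟨a, ha⟩ ⟨b, hb⟩ := hab
        have h2 := φ.map_rel_iff.2 h1
        have h2 : (cycleGraph (n + 3)).Adj (φ ⟨a, ha⟩) (φ ⟨b, hb⟩) := h2
        rw [cycleGraph_adj] at h2
        rcases h2 with h2 | h2
        · refine ⟨φ ⟨b, hb⟩, ?_⟩
          have : φ ⟨b, hb⟩ + 1 = φ ⟨a, ha⟩ := by rw [← h2]; simp
          rw [this, Sym2.eq_swap]; simp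
        · refine ⟨φ ⟨a, ha⟩, ?_⟩
          have : φ ⟨a, ha⟩ + 1 = φ ⟨b, hb⟩ := by rw [← h2]; simp
          rw [this]; simp
      · rintro ⟨i, hi⟩
        have := φ.symm.map_rel_iff.2 (cyc_adj i)
        have h2 : H.Adj (φ.symm i) (φ.symm (i + 1)) := this
        rw [← Subgraph.mem_edgeSet] at h2 ⊢
        rw [← hi]; exact h2
  · rintro ⟨f, hf, hv, he⟩
    refine ⟨RelIso.symm ⟨Equiv.ofBijective (fun i => (⟨f i, by rw [hv]; exact ⟨i, rfl⟩⟩ : H.verts)) ⟨?_, ?_⟩, ?_⟩⟩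
    · intro i j h
      exact hf (by simpa using h)
    · rintro ⟨v, hv'⟩
      rw [hv] at hv'
      obtain ⟨i, rfl⟩ := hv'
      exact ⟨i, rfl⟩
    · intro i j
      simp only [Subgraph.coe_adj]
      rw [← Subgraph.mem_edgeSet, he, cycleGraph_adj]
      simp only [cycE, Finset.coe_image, Finset.coe_univ, Set.image_univ, Set.mem_range, Sym2.eq_iff]
      constructor
      · rintro ⟨k, ⟨h1, h2⟩ | ⟨h1, h2⟩⟩
        · right; rw [← hf h1, ← hf h2]; simp
        · left; rw [← hf h1, ← hf h2]; simp
      · rintro (h | h)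
        · refine ⟨j, Or.inr ⟨rfl, ?_⟩⟩
          rw [← h, add_sub_cancel]; rfl
        · refine ⟨i, Or.inl ⟨rfl, ?_⟩⟩
          rw [← h, add_sub_cancel]; rfl

/-- vertices of a cycle are the vertices covered by its edges -/
lemma range_eq_cover {n : ℕ} (f : Fin (n + 3) → V) : Set.range f = {v | ∃ e ∈ cycE f, v ∈ e} := by
  ext v
  constructor
  · rintro ⟨i, rfl⟩
    exact ⟨_, Finset.mem_image.2 ⟨i, Finset.mem_univ _, rfl⟩, by simp⟩
  · rintro ⟨e, he, hv⟩
    obtain ⟨i, _, rfl⟩ := Finset.mem_image.1 he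
    rcases Sym2.mem_iff.1 hv with rfl | rfl
    · exact ⟨_, rfl⟩
    · exact ⟨_, rfl⟩

lemma cycleCount_eq [Fintype V] (G : SimpleGraph V) [DecidableRel G.Adj] (n : ℕ) :
    cycleCount G (n + 3) =
      {E : Finset (Sym2 V) | E ⊆ G.edgeFinset ∧ MinEven E ∧ E.card = n + 3}.ncard := by
  classical
  unfold cycleCount
  symm
  refine Set.ncard_congr' ?_
  have hfin : ∀ H : G.Subgraph, ∃ E : Finset (Sym2 V), (E : Set (Sym2 V)) = H.edgeSet := fun H =>
    ⟨H.edgeSet.toFinset, by simp⟩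
  choose F hF using hfin
  symm
  refine Equiv.ofBijective (fun H => ⟨F H.1, ?_⟩) ⟨?_, ?_⟩
  · obtain ⟨H, hH⟩ := H
    obtain ⟨f, hf, hv, he⟩ := (subgraph_iso_iff H).1 hH
    have hE : F H = cycE f := by
      apply Finset.coe_injective; rw [hF, he]
    simp only [Set.mem_ofPred_eq, hE]
    refine ⟨?_, cycE_minEven hf, cycE_card hf⟩
    intro e he'
    rw [SimpleGraph.mem_edgeFinset]
    apply H.edgeSet_subset
    rw [he]; exact he'
  · rintro ⟨H, hH⟩ ⟨H', hH'⟩ h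
    obtain ⟨f, hf, hv, he⟩ := (subgraph_iso_iff H).1 hH
    obtain ⟨f', hf', hv', he'⟩ := (subgraph_iso_iff H').1 hH'
    have h1 : F H = F H' := congrArg Subtype.val h
    have h2 : H.edgeSet = H'.edgeSet := by rw [← hF, ← hF, h1]
    have h3 : cycE f = cycE f' := by
      apply Finset.coe_injective; rw [← he, ← he', h2]
    apply Subtype.ext
    apply Subgraph.ext
    · rw [hv, hv', range_eq_cover, range_eq_cover, h3]
    · ext a b
      rw [← Subgraph.mem_edgeSet, h2, Subgraph.mem_edgeSet]
  · rintro ⟨E, hEG, hE, hc⟩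
    obtain ⟨m, f, hf, rfl⟩ := minEven_cyc hE (fun e he => by
      have := SimpleGraph.mem_edgeFinset.1 (hEG he)
      exact G.not_isDiag_of_mem_edgeSet this)
    rw [cycE_card hf] at hc
    obtain rfl : m = n := by omega
    let H : G.Subgraph :=
      { verts := Set.range f
        Adj := fun a b => s(a, b) ∈ cycE f
        adj_sub := fun {a b} h => SimpleGraph.mem_edgeFinset.1 (hEG h)
        edge_vert := fun {a b} h => by
          rw [range_eq_cover]; exact ⟨_, h, by simp⟩
        symm := ⟨fun a b h => by rwa [Sym2.eq_swap]⟩ }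
    have hHe : H.edgeSet = (cycE f : Set (Sym2 V)) := by
      ext e
      induction e with | _ a b
      rfl
    refine ⟨⟨H, (subgraph_iso_iff H).2 ⟨f, hf, rfl, hHe⟩⟩, ?_⟩
    apply Subtype.ext
    apply Finset.coe_injective
    simp only [hF, hHe]

end Cycles


/-! ### Encoding subsets of the Hamiltonian cycle -/

section Encoding

def bitsN (n : ℕ) (d : ℕ → Bool) : ℕ := ∑ k ∈ Finset.range n, (d k).toNat * 32 ^ k

lemma bitsN_succ (n : ℕ) (d : ℕ → Bool) :
    bitsN (n + 1) d = 32 * bitsN n (fun k => d (k + 1)) + (d 0).toNat := by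
  unfold bitsN
  rw [Finset.sum_range_succ', Finset.mul_sum]
  simp only [pow_zero, mul_one]
  congr 1
  exact Finset.sum_congr rfl fun k _ => by ring

lemma land_step (x y : ℕ) (a b : Bool) :
    (32 * x + a.toNat) &&& (32 * y + b.toNat) = 32 * (x &&& y) + (a && b).toNat := by
  have h1 : ((32 * x + a.toNat) &&& (32 * y + b.toNat)) / 2 ^ 5 = x &&& y := by
    rw [Nat.and_div_two_pow]
    have a1 : (32 * x + a.toNat) / 2 ^ 5 = x := by cases a <;> simp <;> omega
    have a2 : (32 * y + b.toNat) / 2 ^ 5 = y := by cases b <;> simp <;> omega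
    rw [a1, a2]
  have h2 : ((32 * x + a.toNat) &&& (32 * y + b.toNat)) % 2 ^ 5 = (a && b).toNat := by
    rw [Nat.and_mod_two_pow]
    have a1 : (32 * x + a.toNat) % 2 ^ 5 = a.toNat := by cases a <;> simp <;> omega
    have a2 : (32 * y + b.toNat) % 2 ^ 5 = b.toNat := by cases b <;> simp <;> omega
    rw [a1, a2]
    cases a <;> cases b <;> rfl
  omega

lemma xor_step (x y : ℕ) (a b : Bool) :
    (32 * x + a.toNat) ^^^ (32 * y + b.toNat) = 32 * (x ^^^ y) + (a ^^ b).toNat := by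
  have h1 : ((32 * x + a.toNat) ^^^ (32 * y + b.toNat)) / 2 ^ 5 = x ^^^ y := by
    rw [Nat.xor_div_two_pow]
    have a1 : (32 * x + a.toNat) / 2 ^ 5 = x := by cases a <;> simp <;> omega
    have a2 : (32 * y + b.toNat) / 2 ^ 5 = y := by cases b <;> simp <;> omega
    rw [a1, a2]
  have h2 : ((32 * x + a.toNat) ^^^ (32 * y + b.toNat)) % 2 ^ 5 = (a ^^ b).toNat := by
    rw [Nat.xor_mod_two_pow]
    have a1 : (32 * x + a.toNat) % 2 ^ 5 = a.toNat := by cases a <;> simp <;> omega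
    have a2 : (32 * y + b.toNat) % 2 ^ 5 = b.toNat := by cases b <;> simp <;> omega
    rw [a1, a2]
    cases a <;> cases b <;> rfl
  omega

lemma bitsN_land (n : ℕ) : ∀ d d' : ℕ → Bool,
    bitsN n d &&& bitsN n d' = bitsN n (fun k => d k && d' k) := by
  induction n with
  | zero => intro d d'; simp [bitsN]
  | succ n ih => intro d d'; rw [bitsN_succ, bitsN_succ, bitsN_succ, land_step, ih]

lemma bitsN_xor (n : ℕ) : ∀ d d' : ℕ → Bool,
    bitsN n d ^^^ bitsN n d' = bitsN n (fun k => d k ^^ d' k) := by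
  induction n with
  | zero => intro d d'; simp [bitsN]
  | succ n ih => intro d d'; rw [bitsN_succ, bitsN_succ, bitsN_succ, xor_step, ih]

lemma bitsN_mod (n : ℕ) (d : ℕ → Bool) :
    bitsN n d % 31 = (∑ k ∈ Finset.range n, (d k).toNat) % 31 := by
  unfold bitsN
  rw [Finset.sum_nat_mod]
  conv_rhs => rw [Finset.sum_nat_mod]
  congr 1
  apply Finset.sum_congr rfl
  intro k _
  rw [Nat.mul_mod, Nat.pow_mod]
  simp

/-- the mask of a set of edges of the Hamiltonian cycle -/
def enc (A : Finset (Fin 17)) : ℕ := bitsN 17 (fun k => decide (Fin.ofNat 17 k ∈ A))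

lemma ofNat_val (i : Fin 17) : Fin.ofNat 17 i.val = i := by
  apply Fin.ext; simp [Fin.ofNat, Nat.mod_eq_of_lt i.2]

lemma enc_land (A B : Finset (Fin 17)) : enc A &&& enc B = enc (A ∩ B) := by
  unfold enc; rw [bitsN_land]; simp

lemma enc_xor (A B : Finset (Fin 17)) : enc A ^^^ enc B = enc (symmDiff A B) := by
  unfold enc; rw [bitsN_xor]
  congr 1; funext k
  generalize Fin.ofNat 17 k = i
  simp only [Finset.mem_symmDiff]
  by_cases h1 : i ∈ A <;> by_cases h2 : i ∈ B <;> simp [h1, h2]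

lemma enc_univ : enc Finset.univ = 1247923426698972051309601 := by decide +kernel

lemma enc_compl (A : Finset (Fin 17)) : enc A ^^^ 1247923426698972051309601 = enc Aᶜ := by
  rw [← enc_univ, enc_xor]
  congr 1
  ext i; simp [Finset.mem_symmDiff]

lemma enc_eq_zero (A : Finset (Fin 17)) : enc A = 0 ↔ A = ∅ := by
  constructor
  · intro h
    rw [enc, bitsN, Finset.sum_eq_zero_iff] at h
    rw [Finset.eq_empty_iff_forall_notMem]
    intro i hi
    have := h i.val (Finset.mem_range.2 i.2)
    rw [ofNat_val] at this
    simp [hi] at this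
  · rintro rfl; simp [enc, bitsN]

lemma enc_inj {A B : Finset (Fin 17)} (h : enc A = enc B) : A = B := by
  have h1 : enc (symmDiff A B) = 0 := by rw [← enc_xor, h, Nat.xor_self]
  rw [enc_eq_zero] at h1
  rwa [← Finset.bot_eq_empty, symmDiff_eq_bot] at h1

lemma enc_mod (A : Finset (Fin 17)) : enc A % 31 = A.card := by
  rw [enc, bitsN_mod]
  have h : ∑ k ∈ Finset.range 17, (decide (Fin.ofNat 17 k ∈ A)).toNat = A.card := by
    rw [Finset.sum_range]
    simp only [ofNat_val]
    rw [Finset.card_eq_sum_ones, ← Finset.sum_filter_add_sum_filter_not Finset.univ (· ∈ A)]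
    rw [Finset.sum_congr rfl (g := fun _ => 1), Finset.sum_congr rfl (s₂ := Finset.univ.filter (· ∉ A)) (g := fun _ => 0)]
    · simp
    · intro i hi; simp at hi; simp [hi]
    · intro i hi; simp at hi; simp [hi]
  rw [h]
  apply Nat.mod_eq_of_lt
  have := Finset.card_le_univ A
  simp at this
  omega

lemma mod_cond (Q N : Finset (Fin 17)) :
    (enc Q &&& enc N) % enc N = 0 ↔ Q ∩ N = ∅ ∨ N ⊆ Q := by
  have hle : enc Q &&& enc N ≤ enc N := Nat.and_le_right
  constructor
  · intro h
    rcases hle.lt_or_eq with h1 | h1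
    · rw [Nat.mod_eq_of_lt h1, enc_land, enc_eq_zero] at h
      exact Or.inl h
    · right
      rw [enc_land] at h1
      exact Finset.inter_eq_right.1 (enc_inj h1)
  · rintro (h | h)
    · rw [enc_land, (enc_eq_zero _).2 h, Nat.zero_mod]
    · rw [enc_land, Finset.inter_eq_right.2 h, Nat.mod_self]

end Encoding

section Ham

/-- edges of the Hamiltonian cycle -/
def hE (i : Fin 17) : Sym2 (Fin 17) := s(i, i + 1)

lemma hE_inj : Function.Injective hE := cyc_edge_inj (n := 14) (f := id) Function.injective_id

def IsCh (e : Sym2 (Fin 17)) : Prop := ¬ e.IsDiag ∧ ∀ i, e ≠ hE i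

instance : DecidablePred IsCh := fun e => by unfold IsCh; infer_instance

def PI (e : Sym2 (Fin 17)) : Finset (Fin 17) := Finset.Ico e.inf e.sup

def chi (A : Finset (Fin 17)) (i : Fin 17) : ZMod 2 := if i ∈ A then 1 else 0

lemma z2_cases (z : ZMod 2) : z = 0 ∨ z = 1 := by revert z; decide
lemma z2_add (z w : ZMod 2) : z + w = 0 ↔ z = w := by revert z w; decide
lemma z2_self (z : ZMod 2) : z + z = 0 := by revert z; decide

lemma PI_par_aux : ∀ a b v : Fin 17, a ≠ b →
    (if v = a ∨ v = b then 1 else 0 : ZMod 2) =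
      (if a ⊓ b ≤ v ∧ v < a ⊔ b then 1 else 0) + (if a ⊓ b ≤ v - 1 ∧ v - 1 < a ⊔ b then 1 else 0) := by
  decide +kernel

lemma PI_par (e : Sym2 (Fin 17)) (he : ¬ e.IsDiag) (v : Fin 17) :
    (if v ∈ e then 1 else 0 : ZMod 2) = chi (PI e) v + chi (PI e) (v - 1) := by
  induction e with | _ a b
  have := PI_par_aux a b v (by simpa using he)
  simp only [Sym2.mem_iff, chi, PI, Finset.mem_Ico, Sym2.inf_mk, Sym2.sup_mk]
  exact this

def PT (T : Finset (Sym2 (Fin 17))) : Finset (Fin 17) :=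
  Finset.univ.filter (fun i => ∑ e ∈ T, chi (PI e) i = 1)

lemma chi_PT (T : Finset (Sym2 (Fin 17))) (i : Fin 17) : chi (PT T) i = ∑ e ∈ T, chi (PI e) i := by
  rw [chi, PT]
  simp only [Finset.mem_filter, Finset.mem_univ, true_and]
  rcases z2_cases (∑ e ∈ T, chi (PI e) i) with h | h <;> simp [h]

lemma chi_ext {A B : Finset (Fin 17)} (h : ∀ i, chi A i = chi B i) : A = B := by
  ext i
  have := h i
  unfold chi at this
  by_cases h1 : i ∈ A <;> by_cases h2 : i ∈ B <;> simp [h1, h2] at this ⊢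

lemma chi_compl (A : Finset (Fin 17)) (i : Fin 17) : chi Aᶜ i = chi A i + 1 := by
  unfold chi
  by_cases h1 : i ∈ A <;> simp [h1]
  decide

lemma chi_symmDiff (A B : Finset (Fin 17)) (i : Fin 17) :
    chi (symmDiff A B) i = chi A i + chi B i := by
  unfold chi
  simp only [Finset.mem_symmDiff]
  by_cases h1 : i ∈ A <;> by_cases h2 : i ∈ B <;> simp [h1, h2]
  decide

def mkE (T : Finset (Sym2 (Fin 17))) (A : Finset (Fin 17)) : Finset (Sym2 (Fin 17)) :=
  T ∪ A.image hE

lemma mem_mkE {T : Finset (Sym2 (Fin 17))} {A : Finset (Fin 17)} {e : Sym2 (Fin 17)} :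
    e ∈ mkE T A ↔ e ∈ T ∨ ∃ i ∈ A, hE i = e := by simp [mkE]

lemma not_ch_hE (i : Fin 17) : ¬ IsCh (hE i) := fun h => h.2 i rfl

lemma mkE_disj {T : Finset (Sym2 (Fin 17))} (hT : ∀ e ∈ T, IsCh e) (A : Finset (Fin 17)) :
    Disjoint T (A.image hE) := by
  rw [Finset.disjoint_left]
  intro e he h
  obtain ⟨i, _, rfl⟩ := Finset.mem_image.1 h
  exact not_ch_hE i (hT _ he)

lemma mkE_card {T : Finset (Sym2 (Fin 17))} (hT : ∀ e ∈ T, IsCh e) (A : Finset (Fin 17)) :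
    (mkE T A).card = T.card + A.card := by
  rw [mkE, Finset.card_union_of_disjoint (mkE_disj hT A), Finset.card_image_of_injective _ hE_inj]

lemma mkE_filter {T : Finset (Sym2 (Fin 17))} (hT : ∀ e ∈ T, IsCh e) (A : Finset (Fin 17)) :
    (mkE T A).filter IsCh = T := by
  ext e
  simp only [Finset.mem_filter, mem_mkE]
  constructor
  · rintro ⟨h | ⟨i, _, rfl⟩, h2⟩
    · exact h
    · exact absurd h2 (not_ch_hE i)
  · intro h; exact ⟨Or.inl h, hT e h⟩

lemma hE_mem_mkE {T : Finset (Sym2 (Fin 17))} (hT : ∀ e ∈ T, IsCh e) (A : Finset (Fin 17))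
    (i : Fin 17) : hE i ∈ mkE T A ↔ i ∈ A := by
  rw [mem_mkE]
  constructor
  · rintro (h | ⟨j, hj, h⟩)
    · exact absurd (hT _ h) (not_ch_hE i)
    · rwa [← hE_inj h]
  · intro h; exact Or.inr ⟨i, h, rfl⟩

lemma mkE_subset {T T' : Finset (Sym2 (Fin 17))} (hT : ∀ e ∈ T, IsCh e) (hT' : ∀ e ∈ T', IsCh e)
    (A A' : Finset (Fin 17)) : mkE T' A' ⊆ mkE T A ↔ T' ⊆ T ∧ A' ⊆ A := by
  constructor
  · intro h
    constructor
    · rw [← mkE_filter hT A, ← mkE_filter hT' A']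
      exact Finset.filter_subset_filter _ h
    · intro i hi
      exact (hE_mem_mkE hT A i).1 (h ((hE_mem_mkE hT' A' i).2 hi))
  · rintro ⟨h1, h2⟩
    exact Finset.union_subset_union h1 (Finset.image_subset_image h2)

lemma mkE_inj {T T' : Finset (Sym2 (Fin 17))} (hT : ∀ e ∈ T, IsCh e) (hT' : ∀ e ∈ T', IsCh e)
    {A A' : Finset (Fin 17)} (h : mkE T' A' = mkE T A) : T' = T ∧ A' = A := by
  have h1 := (mkE_subset hT hT' A A').1 h.subset
  have h2 := (mkE_subset hT' hT A' A).1 h.symm.subset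
  exact ⟨h1.1.antisymm h2.1, h1.2.antisymm h2.2⟩

lemma exists_mkE {E : Finset (Sym2 (Fin 17))} (hE' : ∀ e ∈ E, ¬ e.IsDiag) :
    E = mkE (E.filter IsCh) (Finset.univ.filter (fun i => hE i ∈ E)) := by
  ext e
  simp only [mem_mkE, Finset.mem_filter, Finset.mem_univ, true_and]
  constructor
  · intro h
    by_cases hc : IsCh e
    · exact Or.inl ⟨h, hc⟩
    · right
      unfold IsCh at hc
      push Not at hc
      obtain ⟨i, rfl⟩ := hc (hE' e h)
      exact ⟨i, h, rfl⟩
  · rintro (h | ⟨i, h, rfl⟩)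
    · exact h.1
    · exact h

lemma mem_hE (v i : Fin 17) : v ∈ hE i ↔ i = v ∨ i = v - 1 :=
  mem_cyc_edge (n := 14) (f := id) Function.injective_id v i

lemma par_mkE {T : Finset (Sym2 (Fin 17))} (hT : ∀ e ∈ T, IsCh e) (A : Finset (Fin 17))
    (v : Fin 17) : par (mkE T A) v
      = (chi A v + chi (PT T) v) + (chi A (v - 1) + chi (PT T) (v - 1)) := by
  unfold par mkE
  rw [Finset.sum_union (mkE_disj hT A), Finset.sum_image (fun a _ b _ h => hE_inj h)]
  have h1 : (∑ e ∈ T, if v ∈ e then 1 else 0 : ZMod 2) = chi (PT T) v + chi (PT T) (v - 1) := by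
    rw [chi_PT, chi_PT, ← Finset.sum_add_distrib]
    exact Finset.sum_congr rfl fun e he => PI_par e (hT e he).1 v
  have h2 : (∑ i ∈ A, if v ∈ hE i then 1 else 0 : ZMod 2) = chi A v + chi A (v - 1) := by
    have : (∑ i ∈ A, if v ∈ hE i then 1 else 0 : ZMod 2)
        = ∑ i, if i ∈ A ∧ v ∈ hE i then 1 else 0 := by
      rw [← Finset.sum_filter, ← Finset.sum_filter]
      apply Finset.sum_congr _ (fun _ _ => rfl)
      ext i; simp
    rw [this, Finset.sum_eq_add_of_mem v (v - 1) (Finset.mem_univ _) (Finset.mem_univ _)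
      (fin_sub_one_ne (n := 14) v).symm]
    · simp [mem_hE, chi]
    · rintro j _ ⟨h1, h2⟩
      simp [mem_hE, h1, h2]
  rw [h1, h2]; ring

lemma evenE_mkE {T : Finset (Sym2 (Fin 17))} (hT : ∀ e ∈ T, IsCh e) (A : Finset (Fin 17)) :
    EvenE (mkE T A) ↔ A = PT T ∨ A = (PT T)ᶜ := by
  constructor
  · intro h
    have hc : ∀ v : Fin 17, chi A v + chi (PT T) v = chi A 0 + chi (PT T) 0 := by
      intro v
      induction v using Fin.induction with
      | zero => rfl
      | succ d ih =>
        have := h d.succ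
        rw [par_mkE hT, z2_add] at this
        rw [this, ← ih, ← Fin.coeSucc_eq_succ, add_sub_cancel_right]
    rcases z2_cases (chi A 0 + chi (PT T) 0) with h0 | h0
    · left
      apply chi_ext
      intro i
      have := hc i
      rwa [h0, z2_add] at this
    · right
      apply chi_ext
      intro i
      have := hc i
      rw [h0] at this
      rw [chi_compl, ← this, add_comm (chi A i), ← add_assoc, z2_self, zero_add]
  · rintro (rfl | rfl) v
    · rw [par_mkE hT, z2_self, z2_self, add_zero]
    · rw [par_mkE hT]
      simp only [chi_compl]
      rw [z2_add]
      have : ∀ z : ZMod 2, z + 1 + z = 1 := by decide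
      rw [this, this]

lemma PT_empty : PT ∅ = ∅ := by
  apply chi_ext; intro i; rw [chi_PT]; simp [chi]

lemma PT_insert {c : Sym2 (Fin 17)} {T : Finset (Sym2 (Fin 17))} (hc : c ∉ T) :
    PT (insert c T) = symmDiff (PI c) (PT T) := by
  apply chi_ext; intro i
  rw [chi_symmDiff, chi_PT, chi_PT, Finset.sum_insert hc]

lemma par_sdiff {E E' : Finset (Sym2 (Fin 17))} (h : E' ⊆ E) (v : Fin 17) :
    par (E \ E') v + par E' v = par E v := Finset.sum_sdiff h

lemma PI_inf_mem {e : Sym2 (Fin 17)} (he : ¬ e.IsDiag) : e.inf ∈ PI e := by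
  induction e with | _ a b
  simp only [PI, Finset.mem_Ico, Sym2.inf_mk, Sym2.sup_mk, le_refl, true_and]
  have : a ≠ b := by simpa using he
  exact inf_lt_sup.2 this

lemma PI_last (e : Sym2 (Fin 17)) : (Fin.last 16) ∉ PI e := by
  simp only [PI, Finset.mem_Ico, not_and, not_lt]
  intro _; exact Fin.le_last _

/-- criterion for minimality -/
lemma minEven_iff {T : Finset (Sym2 (Fin 17))} (hT : ∀ e ∈ T, IsCh e) {c : Sym2 (Fin 17)}
    (hc : IsCh c) (hcT : c ∉ T) (A : Finset (Fin 17)) (hA : EvenE (mkE (insert c T) A)) :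
    MinEven (mkE (insert c T) A) ↔
      ∀ T' ⊆ T, T'.Nonempty → ¬ PT T' ⊆ A ∧ ¬ (PT T')ᶜ ⊆ A := by
  have hcT' : ∀ e ∈ insert c T, IsCh e := by
    intro e he
    rcases Finset.mem_insert.1 he with rfl | h
    · exact hc
    · exact hT e h
  constructor
  · intro hm T' hT' hne
    have hch : ∀ e ∈ T', IsCh e := fun e he => hT e (hT' he)
    have key : ∀ B, (B = PT T' ∨ B = (PT T')ᶜ) → ¬ B ⊆ A := by
      intro B hB hBA
      have h1 := (evenE_mkE hch B).2 hB
      have h2 := hm.2.2 (mkE T' B)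
        ((mkE_subset hcT' hch A B).2 ⟨hT'.trans (Finset.subset_insert _ _), hBA⟩)
        (by obtain ⟨e, he⟩ := hne; exact ⟨e, mem_mkE.2 (Or.inl he)⟩) h1
      have h3 := (mkE_inj hcT' hch h2).1
      apply hcT
      apply hT'
      rw [h3]; simp
    exact ⟨key _ (Or.inl rfl), key _ (Or.inr rfl)⟩
  · intro h
    have hdiag : ∀ e ∈ mkE (insert c T) A, ¬ e.IsDiag := by
      intro e he
      rcases mem_mkE.1 he with h | ⟨i, _, rfl⟩
      · exact (hcT' e h).1
      · rw [hE, Sym2.mk_isDiag_iff]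
        exact (fin_add_one_ne (n := 14) i).symm
    -- even subsets avoiding `c` are empty
    have key : ∀ E ⊆ mkE (insert c T) A, EvenE E → c ∉ E → E = ∅ := by
      intro E hEs hEe hcE
      have hd : ∀ e ∈ E, ¬ e.IsDiag := fun e he => hdiag e (hEs he)
      have hEq := exists_mkE hd
      set T' := E.filter IsCh with hT'def
      set B := Finset.univ.filter (fun i => hE i ∈ E)
      have hch : ∀ e ∈ T', IsCh e := fun e he => (Finset.mem_filter.1 he).2
      rw [hEq] at hEs hEe
      have hsub := (mkE_subset hcT' hch A B).1 hEs
      have hT'T : T' ⊆ T := by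
        rw [← Finset.subset_insert_iff_of_notMem (a := c)]
        · exact hsub.1
        · intro hcon; exact hcE (Finset.mem_filter.1 hcon).1
      have hB := (evenE_mkE hch B).1 hEe
      by_cases hne : T'.Nonempty
      · exfalso
        have := h T' hT'T hne
        rcases hB with hB | hB
        · exact this.1 (hB ▸ hsub.2)
        · exact this.2 (hB ▸ hsub.2)
      · rw [Finset.not_nonempty_iff_eq_empty] at hne
        rw [hne, PT_empty] at hB
        rcases hB with hB | hB
        · rw [hEq, hne, hB]; rfl
        · exfalso
          rw [Finset.compl_empty] at hB
          have hAu : A = Finset.univ := by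
            rw [hB] at hsub
            exact Finset.univ_subset_iff.1 hsub.2
          by_cases hTn : T.Nonempty
          · exact (h T subset_rfl hTn).1 (by rw [hAu]; exact Finset.subset_univ _)
          · rw [Finset.not_nonempty_iff_eq_empty] at hTn
            have hA' := (evenE_mkE hcT' A).1 hA
            rw [PT_insert hcT, hTn, PT_empty] at hA'
            have hs : symmDiff (PI c) ∅ = PI c := symmDiff_bot (PI c)
            rw [hs, hAu] at hA'
            rcases hA' with h1 | h1
            · exact PI_last c (h1 ▸ Finset.mem_univ _)
            · have : c.inf ∈ (PI c)ᶜ := h1 ▸ Finset.mem_univ _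
              exact (Finset.mem_compl.1 this) (PI_inf_mem hc.1)
    refine ⟨⟨c, mem_mkE.2 (Or.inl (by simp))⟩, hA, ?_⟩
    intro E' hE' hne hev
    by_cases hcE : c ∈ E'
    · have : mkE (insert c T) A \ E' = ∅ := by
        apply key _ Finset.sdiff_subset
        · intro v
          have := par_sdiff hE' v
          rw [hev v, hA v, add_zero] at this
          exact this
        · simp [hcE]
      exact hE'.antisymm (Finset.sdiff_eq_empty_iff_subset.1 this)
    · rw [key E' hE' hev hcE] at hne
      simp at hne

/-- mask of a chord -/
def msk (e : Sym2 (Fin 17)) : ℕ := enc (PI e)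

lemma msk_inj {e e' : Sym2 (Fin 17)} (he : ¬ e.IsDiag) (he' : ¬ e'.IsDiag) (h : msk e = msk e') :
    e = e' := by
  have h1 : PI e = PI e' := enc_inj h
  rw [← Sym2.inf_eq_inf_and_sup_eq_sup]
  have a1 := PI_inf_mem he
  have a2 := PI_inf_mem he'
  have b1 : e.inf ∈ PI e' := h1 ▸ a1
  have b2 : e'.inf ∈ PI e := h1 ▸ a2
  simp only [PI, Finset.mem_Ico] at a1 a2 b1 b2
  have hi : e.inf = e'.inf := le_antisymm b2.1 b1.1
  refine ⟨hi, ?_⟩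
  have hcard := congrArg Finset.card h1
  simp only [PI, Fin.card_Ico] at hcard
  rw [hi] at hcard
  have c1 : e'.inf.val < e.sup.val := b2.2
  have c2 : e'.inf.val < e'.sup.val := a2.2
  apply Fin.ext
  omega

lemma msk_injOn {T : Finset (Sym2 (Fin 17))} (hT : ∀ e ∈ T, IsCh e) :
    Set.InjOn msk (T : Set (Sym2 (Fin 17))) := fun e he e' he' h =>
  msk_inj (hT e he).1 (hT e' he').1 h

lemma PX_image {T : Finset (Sym2 (Fin 17))} (hT : ∀ e ∈ T, IsCh e) :
    PX (T.image msk) = enc (PT T) := by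
  induction T using Finset.induction_on with
  | empty => rw [PT_empty, (enc_eq_zero _).2 rfl]; rfl
  | insert c T hc ih =>
    have hT' : ∀ e ∈ T, IsCh e := fun e he => hT e (by simp [he])
    rw [Finset.image_insert, PX_insert, ih hT', PT_insert hc, ← enc_xor]
    · rfl
    · intro h
      obtain ⟨c', hc', h'⟩ := Finset.mem_image.1 h
      rw [msk_inj (hT' c' hc').1 (hT c (by simp)).1 h'] at hc'
      exact hc hc'

lemma okN_min {T : Finset (Sym2 (Fin 17))} (hT : ∀ e ∈ T, IsCh e) {c : Sym2 (Fin 17)}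
    (hc : IsCh c) (hcT : c ∉ T) (A : Finset (Fin 17)) (hA : EvenE (mkE (insert c T) A))
    {e : Ent} (he : IsEnt e (T.image msk)) (x : ℕ) [Decidable (MinEven (mkE (insert c T) A))] :
    okN (enc Aᶜ) e.l x = if MinEven (mkE (insert c T) A) then x else 0 := by
  rw [okN_eq]
  apply if_congr _ rfl rfl
  rw [minEven_iff hT hc hcT A hA]
  constructor
  · intro h T' hT' hne
    have hch : ∀ e ∈ T', IsCh e := fun e he => hT e (hT' he)
    have := h (enc (PT T')) ((he.2.2 _).2 ⟨T'.image msk, Finset.image_subset_image hT', by simpa using hne,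
      PX_image hch⟩)
    rw [Ne, mod_cond, not_or] at this
    refine ⟨fun h1 => this.1 ?_, fun h1 => this.2 ?_⟩
    · rw [← Finset.disjoint_iff_inter_eq_empty]
      exact disjoint_compl_right.mono_left h1
    · rw [← compl_compl (PT T')]
      exact Finset.compl_subset_compl.2 h1
  · intro h q hq
    obtain ⟨Tm, hTm, hne, rfl⟩ := (he.2.2 q).1 hq
    obtain ⟨T', hT', rfl⟩ := Finset.subset_image_iff.1 hTm
    have hT' : T' ⊆ T := by exact_mod_cast hT'
    have hch : ∀ e ∈ T', IsCh e := fun e he => hT e (hT' he)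
    have := h T' hT' (by simpa using hne)
    rw [PX_image hch, Ne, mod_cond, not_or]
    refine ⟨fun h1 => this.1 ?_, fun h1 => this.2 ?_⟩
    · rw [← Finset.disjoint_iff_inter_eq_empty] at h1
      exact disjoint_compl_right_iff.1 h1
    · have := Finset.compl_subset_compl.2 h1
      rwa [compl_compl] at this

end Ham

/-! ### The multiset of cycle lengths -/

section Lengths

noncomputable def contribL (p : ℕ) (e : Ent) : List ℕ :=
  (if okN (e.m ^^^ p) e.l 1 = 1 then [18 + e.t - (e.m ^^^ p) % 31] else []) ++
  (if okN ((e.m ^^^ p) ^^^ 1247923426698972051309601) e.l 1 = 1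
    then [(e.m ^^^ p) % 31 + (e.t + 1)] else [])

lemma okN_one (N : ℕ) (l : List ℕ) (x : ℕ) :
    okN N l x = mval ((if okN N l 1 = 1 then [0] else [] : List ℕ) : Multiset ℕ) * x := by
  rw [okN_eq, okN_eq]
  split_ifs with h1 h2 <;> simp_all [mval]

lemma contrib_eq_contribL (p : ℕ) (e : Ent) :
    contrib p e = mval (contribL p e : Multiset ℕ) := by
  have h : contrib p e = okN (e.m ^^^ p) e.l (16 ^ (18 + e.t - (e.m ^^^ p) % 31))
      + okN ((e.m ^^^ p) ^^^ 1247923426698972051309601) e.l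
        (16 ^ ((e.m ^^^ p) % 31 + (e.t + 1))) := rfl
  rw [h, contribL, ← Multiset.coe_add, mval_add, okN_one _ _ (16 ^ _), okN_one _ _ (16 ^ _)]
  congr 1
  · split_ifs <;> simp [mval]
  · split_ifs <;> simp [mval]

open Classical in
noncomputable def cycSet (D : Finset (Sym2 (Fin 17))) : Finset (Finset (Sym2 (Fin 17))) :=
  (mkE D Finset.univ).powerset.filter MinEven

open Classical in
noncomputable def LenM (D : Finset (Sym2 (Fin 17))) (Tm : Finset ℕ) : Multiset ℕ :=
  ∑ E ∈ (cycSet D).filter (fun E => (E.filter IsCh).image msk = Tm), {E.card}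

lemma mem_cycSet {D E : Finset (Sym2 (Fin 17))} :
    E ∈ cycSet D ↔ E ⊆ mkE D Finset.univ ∧ MinEven E := by simp [cycSet]

lemma mkE_diag {D : Finset (Sym2 (Fin 17))} (hD : ∀ e ∈ D, IsCh e) (A : Finset (Fin 17)) :
    ∀ e ∈ mkE D A, ¬ e.IsDiag := by
  intro e he
  rcases mem_mkE.1 he with h | ⟨i, _, rfl⟩
  · exact (hD e h).1
  · rw [hE, Sym2.mk_isDiag_iff]
    exact (fin_add_one_ne (n := 14) i).symm

lemma image_msk_inj {D T T' : Finset (Sym2 (Fin 17))} (hD : ∀ e ∈ D, IsCh e) (hT : T ⊆ D)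
    (hT' : T' ⊆ D) (h : T.image msk = T'.image msk) : T = T' := by
  have key : ∀ T T' : Finset (Sym2 (Fin 17)), T ⊆ D → T' ⊆ D → T.image msk = T'.image msk → T ⊆ T' := by
    intro T T' hT hT' h e he
    have : msk e ∈ T'.image msk := h ▸ Finset.mem_image_of_mem _ he
    obtain ⟨e', he', h'⟩ := Finset.mem_image.1 this
    rwa [← msk_inj (hD e' (hT' he')).1 (hD e (hT he)).1 h']
  exact (key T T' hT hT' h).antisymm (key T' T hT' hT h.symm)

lemma sum_LenM {D : Finset (Sym2 (Fin 17))} (hD : ∀ e ∈ D, IsCh e) :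
    ∑ Tm ∈ (D.image msk).powerset, LenM D Tm = ∑ E ∈ cycSet D, {E.card} := by
  classical
  unfold LenM
  apply Finset.sum_fiberwise_of_maps_to
  intro E hE'
  rw [Finset.mem_powerset]
  apply Finset.image_subset_image
  rw [mem_cycSet] at hE'
  rw [← mkE_filter hD Finset.univ]
  exact Finset.filter_subset_filter _ hE'.1

lemma LenM_filter {D T : Finset (Sym2 (Fin 17))} (hD : ∀ e ∈ D, IsCh e) (hT : T ⊆ D) :
    LenM D (T.image msk) = ∑ E ∈ (cycSet D).filter (fun E => E = mkE T (PT T) ∨ E = mkE T (PT T)ᶜ),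
      ({E.card} : Multiset ℕ) := by
  unfold LenM
  have hch : ∀ e ∈ T, IsCh e := fun e he => hD e (hT he)
  congr 1
  apply Finset.filter_congr
  intro E hE'
  rw [mem_cycSet] at hE'
  have hd : ∀ e ∈ E, ¬ e.IsDiag := fun e he => mkE_diag hD _ e (hE'.1 he)
  constructor
  · intro h
    have h1 : E.filter IsCh = T := by
      apply image_msk_inj hD _ hT h
      rw [← mkE_filter hD Finset.univ]
      exact Finset.filter_subset_filter _ hE'.1
    have h2 := exists_mkE hd
    rw [h1] at h2
    have h3 := hE'.2.2.1
    rw [h2, evenE_mkE hch] at h3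
    rcases h3 with h3 | h3
    · left; rw [h3] at h2; exact h2
    · right; rw [h3] at h2; exact h2
  · rintro (rfl | rfl)
    · rw [mkE_filter hch]
    · rw [mkE_filter hch]

lemma ne_compl_fin (A : Finset (Fin 17)) : A ≠ Aᶜ := by
  intro h
  have h0 : (0 : Fin 17) ∈ A ↔ (0 : Fin 17) ∈ Aᶜ := by rw [← h]
  simp at h0

lemma LenM_pair {D T : Finset (Sym2 (Fin 17))} (hD : ∀ e ∈ D, IsCh e) (hT : T ⊆ D)
    [Decidable (MinEven (mkE T (PT T)))] [Decidable (MinEven (mkE T (PT T)ᶜ))] :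
    LenM D (T.image msk) = (if MinEven (mkE T (PT T)) then {(mkE T (PT T)).card} else 0) +
      (if MinEven (mkE T (PT T)ᶜ) then {(mkE T (PT T)ᶜ).card} else 0) := by
  classical
  have hch : ∀ e ∈ T, IsCh e := fun e he => hD e (hT he)
  rw [LenM_filter hD hT]
  have hs : (cycSet D).filter (fun E => E = mkE T (PT T) ∨ E = mkE T (PT T)ᶜ)
      = ({mkE T (PT T), mkE T (PT T)ᶜ} : Finset (Finset (Sym2 (Fin 17)))).filter MinEven := by
    ext E
    simp only [Finset.mem_filter, mem_cycSet, Finset.mem_insert, Finset.mem_singleton]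
    constructor
    · rintro ⟨h1, h2⟩; exact ⟨h2, h1.2⟩
    · rintro ⟨h1, h2⟩
      refine ⟨⟨?_, h2⟩, h1⟩
      rcases h1 with rfl | rfl
      · exact (mkE_subset hD hch _ _).2 ⟨hT, Finset.subset_univ _⟩
      · exact (mkE_subset hD hch _ _).2 ⟨hT, Finset.subset_univ _⟩
  rw [hs, Finset.sum_filter, Finset.sum_pair]
  · congr 1 <;> congr 1
  · intro h
    exact ne_compl_fin _ (mkE_inj hch hch h).2

lemma LenM_empty {D : Finset (Sym2 (Fin 17))} (hD : ∀ e ∈ D, IsCh e) : LenM D ∅ = {17} := by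
  classical
  have h := LenM_pair (T := ∅) hD (by simp)
  rw [Finset.image_empty] at h
  rw [h, PT_empty, Finset.compl_empty]
  have h1 : ¬ MinEven (mkE ∅ ∅) := fun h => by
    have := h.1
    simp [mkE] at this
  have h2 : mkE ∅ Finset.univ = cycE (n := 14) (V := Fin 17) id := by
    ext e
    simp [mem_mkE, cycE, hE]
  have h3 : MinEven (mkE ∅ Finset.univ) := by
    rw [h2]; exact cycE_minEven Function.injective_id
  rw [if_neg h1, if_pos h3, mkE_card (by simp)]
  simp

lemma LenM_step {D T : Finset (Sym2 (Fin 17))} (hD : ∀ e ∈ D, IsCh e) (hT : T ⊆ D)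
    {c : Sym2 (Fin 17)} (hc : c ∈ D) (hcT : c ∉ T) {e : Ent} (he : IsEnt e (T.image msk)) :
    LenM D ((insert c T).image msk) = (contribL (msk c) e : Multiset ℕ) := by
  classical
  have hch : ∀ e ∈ T, IsCh e := fun e he => hD e (hT he)
  have hcs : insert c T ⊆ D := Finset.insert_subset hc hT
  have hch' : ∀ e ∈ insert c T, IsCh e := fun e he => hD e (hcs he)
  rw [LenM_pair hD hcs]
  have hM : e.m ^^^ msk c = enc (PT (insert c T)) := by
    rw [he.1, PX_image hch, PT_insert hcT, ← enc_xor, Nat.xor_comm]; rfl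
  have ht : e.t = T.card := by
    rw [he.2.1, Finset.card_image_of_injOn (msk_injOn hch)]
  have hm31 : (e.m ^^^ msk c) % 31 = (PT (insert c T)).card := by rw [hM, enc_mod]
  have o1 := okN_min hch (hD c hc) hcT (PT (insert c T))
    ((evenE_mkE hch' _).2 (Or.inl rfl)) he 1
  have o2 := okN_min hch (hD c hc) hcT (PT (insert c T))ᶜ
    ((evenE_mkE hch' _).2 (Or.inr rfl)) he 1
  rw [compl_compl] at o2
  unfold contribL
  rw [hm31, hM, enc_compl, o1, o2, ← Multiset.coe_add, add_comm]
  have c1 : (mkE (insert c T) (PT (insert c T))).card = (PT (insert c T)).card + (e.t + 1) := by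
    rw [mkE_card hch', Finset.card_insert_of_notMem hcT, ht, add_comm]
  have c2 : (mkE (insert c T) (PT (insert c T))ᶜ).card = 18 + e.t - (PT (insert c T)).card := by
    rw [mkE_card hch', Finset.card_insert_of_notMem hcT, ht, Finset.card_compl]
    have := Finset.card_le_univ (PT (insert c T))
    simp only [Fintype.card_fin] at this ⊢
    omega
  rw [c1, c2]
  congr 1
  · split_ifs <;> simp_all
  · split_ifs <;> simp_all

lemma cycSet_card_mem {D : Finset (Sym2 (Fin 17))} (hD : ∀ e ∈ D, IsCh e)
    {E : Finset (Sym2 (Fin 17))} (h : E ∈ cycSet D) : 3 ≤ E.card ∧ E.card ≤ 17 := by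
  rw [mem_cycSet] at h
  obtain ⟨n, f, hf, rfl⟩ := minEven_cyc h.2 (fun e he => mkE_diag hD _ e (h.1 he))
  rw [cycE_card hf]
  have := Fintype.card_le_of_injective f hf
  simp at this
  omega

lemma count_LenM {D : Finset (Sym2 (Fin 17))} (hD : ∀ e ∈ D, IsCh e) (G : SimpleGraph (Fin 17))
    (hG : G.edgeSet = (mkE D Finset.univ : Set (Sym2 (Fin 17)))) (k : ℕ) (hk : 3 ≤ k) :
    (∑ Tm ∈ (D.image msk).powerset, LenM D Tm).count k = cycleCount G k := by
  classical
  obtain ⟨n, rfl⟩ : ∃ n, k = n + 3 := ⟨k - 3, by omega⟩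
  rw [cycleCount_eq, sum_LenM hD, Multiset.count_sum']
  have h1 : ∑ E ∈ cycSet D, Multiset.count (n + 3) {E.card}
      = ((cycSet D).filter (fun E => E.card = n + 3)).card := by
    rw [Finset.card_filter]
    apply Finset.sum_congr rfl
    intro E _
    rw [Multiset.count_singleton]
    apply if_congr _ rfl rfl
    exact eq_comm
  have h2 : G.edgeFinset = mkE D Finset.univ := by
    apply Finset.coe_injective
    rw [coe_edgeFinset, hG]
  rw [h1, h2, ← Set.ncard_coe_finset]
  congr 1
  ext E
  simp [mem_cycSet, and_assoc]

lemma msk_allCh_aux : ∀ a b : Fin 17, a < b → (b ≠ a + 1) → a ≠ b + 1 → enc (Finset.Ico a b) ∈ allCh := by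
  decide +kernel

lemma msk_allCh {e : Sym2 (Fin 17)} (h : IsCh e) : msk e ∈ allCh := by
  induction e with | _ a b
  have h0 : a ≠ b := by simpa using h.1
  have h1 : b ≠ a + 1 := by
    rintro rfl; exact h.2 a rfl
  have h2 : a ≠ b + 1 := by
    rintro rfl; exact h.2 b (Sym2.eq_swap)
  unfold msk PI
  simp only [Sym2.inf_mk, Sym2.sup_mk]
  rcases lt_or_gt_of_ne h0 with h3 | h3
  · rw [inf_eq_left.2 h3.le, sup_eq_right.2 h3.le]
    exact msk_allCh_aux a b h3 h1 h2
  · rw [inf_eq_right.2 h3.le, sup_eq_left.2 h3.le]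
    exact msk_allCh_aux b a h3 h2 h1

lemma model_of {D : Finset (Sym2 (Fin 17))} (hD : ∀ e ∈ D, IsCh e) (G : SimpleGraph (Fin 17))
    (hG : G.edgeSet = (mkE D Finset.univ : Set (Sym2 (Fin 17))))
    (hcyc : ∀ k, 3 ≤ k → k ≤ 17 → cycleCount G k = 2) : Model (D.image msk) (LenM D) where
  empty := LenM_empty hD
  step := by
    intro Tm hTm p hp hpT e he
    obtain ⟨T, hT, rfl⟩ := Finset.subset_image_iff.1 hTm
    have hT : T ⊆ D := by exact_mod_cast hT
    obtain ⟨c, hc, rfl⟩ := Finset.mem_image.1 hp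
    have hcT : c ∉ T := fun h => hpT (Finset.mem_image_of_mem _ h)
    rw [contrib_eq_contribL, ← LenM_step hD hT hc hcT he, Finset.image_insert]
  count := by
    intro k h3 h17
    rw [count_LenM hD G hG k h3, hcyc k h3 h17]
  mem := by
    intro k hk
    rw [sum_LenM hD, Multiset.mem_sum] at hk
    obtain ⟨E, hE', hk⟩ := hk
    rw [Multiset.mem_singleton] at hk
    subst hk
    exact cycSet_card_mem hD hE'
  ch := by
    intro p hp
    obtain ⟨c, hc, rfl⟩ := Finset.mem_image.1 hp
    exact msk_allCh (hD c hc)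

/-- forward computation of all lengths -/
noncomputable def calcE : List ℕ → List Ent
  | [] => [⟨0, 0, []⟩]
  | p :: S => calcE S ++ (calcE S).map (extE p)

noncomputable def calcM : List ℕ → List ℕ
  | [] => [17]
  | p :: S => calcM S ++ (calcE S).flatMap (contribL p)

lemma calc_spec {D : Finset (Sym2 (Fin 17))} (hD : ∀ e ∈ D, IsCh e) :
    ∀ S : List ℕ, S.Nodup → S.toFinset ⊆ D.image msk →
      EntS (calcE S) (subs S) ∧ (calcM S : Multiset ℕ) = tot (LenM D) (subs S) := by
  intro S
  induction S with
  | nil =>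
    intro _ _
    refine ⟨?_, ?_⟩
    · refine List.Forall₂.cons ⟨rfl, rfl, ?_⟩ List.Forall₂.nil
      intro q
      simp only [List.not_mem_nil, false_iff, not_exists, not_and]
      rintro T' h1 h2
      rw [Finset.subset_empty.1 h1] at h2
      simp at h2
    · simp only [subs, tot_cons, tot_nil, calcM, LenM_empty hD]; rfl
  | cons p S ih =>
    intro hn hs
    have hn' := List.nodup_cons.1 hn
    have hs' : S.toFinset ⊆ D.image msk := fun x hx => hs (by simp at hx; simp [hx])
    obtain ⟨h1, h2⟩ := ih hn'.2 hs'
    have hpT : ∀ T ∈ subs S, p ∉ T := by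
      intro T hT hp
      have := (mem_subs S T).1 hT hp
      simp at this
      exact hn'.1 this
    have h3 : ∀ (es : List Ent) (Ts : List (Finset ℕ)), EntS es Ts → (∀ T ∈ Ts, p ∉ T) →
        (∀ T ∈ Ts, T ⊆ S.toFinset) → 
        (es.flatMap (contribL p) : Multiset ℕ) = tot (LenM D) (Ts.map (fun T => insert p T)) := by
      intro es Ts h
      induction h with
      | nil => intro _ _; rfl
      | @cons e T es Ts he _ ih2 =>
        intro a b
        rw [List.flatMap_cons, ← Multiset.coe_add, List.map_cons, tot_cons,
          ih2 (fun T hT => a T (by simp [hT])) (fun T hT => b T (by simp [hT]))]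
        congr 1
        have hTm := (b T (by simp)).trans hs'
        obtain ⟨T', hT', rfl⟩ := Finset.subset_image_iff.1 hTm
        have hT' : T' ⊆ D := by exact_mod_cast hT'
        have hp : p ∈ D.image msk := hs (by simp)
        obtain ⟨c, hc, rfl⟩ := Finset.mem_image.1 hp
        have hcT : c ∉ T' := fun h => a _ (by simp) (Finset.mem_image_of_mem _ h)
        rw [← LenM_step hD hT' hc hcT he, Finset.image_insert]
    refine ⟨?_, ?_⟩
    · have h4 := entS_ext (p := p) h1 hpT
      rw [ext_eq] at h4
      exact List.rel_append h1 h4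
    · have := h3 _ _ h1 hpT (fun T hT => (mem_subs S T).1 hT)
      simp only [calcM, subs]
      rw [← Multiset.coe_add, h2, this, tot_append]

end Lengths

/-! ### Invariance under isomorphism -/

section Invariance

lemma cycleCount_le {V W : Type*} [Fintype V] [Fintype W] {G : SimpleGraph V} {G' : SimpleGraph W}
    (φ : G ≃g G') (n : ℕ) : cycleCount G (n + 3) ≤ cycleCount G' (n + 3) := by
  classical
  unfold cycleCount
  apply Set.ncard_le_ncard_of_injOn (fun H => H.map φ.toHom) _ _ (Set.toFinite _)
  · intro H hH
    obtain ⟨f, hf, h1, h2⟩ := (subgraph_iso_iff H).1 hH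
    refine (subgraph_iso_iff _).2 ⟨fun i => φ (f i), φ.injective.comp hf, ?_, ?_⟩
    · rw [Subgraph.map_verts, h1, ← Set.range_comp]; rfl
    · rw [Subgraph.edgeSet_map, h2]
      ext e
      simp only [cycE, Set.mem_image, Finset.mem_coe, Finset.mem_image, Finset.mem_univ, true_and]
      constructor
      · rintro ⟨_, ⟨i, rfl⟩, rfl⟩; exact ⟨i, rfl⟩
      · rintro ⟨i, rfl⟩; exact ⟨_, ⟨i, rfl⟩, rfl⟩
  · intro H1 _ H2 _ h
    have h' : H1.map φ.toHom = H2.map φ.toHom := h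
    have h'' := congrArg (fun H => Subgraph.map φ.symm.toHom H) h'
    simp only [← Subgraph.map_comp] at h''
    have hid : φ.symm.toHom.comp φ.toHom = Hom.id := by
      ext v; simp
    rw [hid, Subgraph.map_id, Subgraph.map_id] at h''
    exact h''

lemma cycleCount_congr {V W : Type*} [Fintype V] [Fintype W] {G : SimpleGraph V}
    {G' : SimpleGraph W} (φ : G ≃g G') (k : ℕ) (hk : 3 ≤ k) :
    cycleCount G k = cycleCount G' k := by
  obtain ⟨n, rfl⟩ : ∃ n, k = n + 3 := ⟨k - 3, by omega⟩
  exact le_antisymm (cycleCount_le φ n) (cycleCount_le φ.symm n)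

lemma edge_ncard_congr {V W : Type*} {G : SimpleGraph V}
    {G' : SimpleGraph W} (φ : G ≃g G') : G.edgeSet.ncard = G'.edgeSet.ncard :=
  Set.ncard_congr' φ.mapEdgeSet

/-- graphs on `Fin 17` containing the standard Hamiltonian cycle -/
structure Nice (G : SimpleGraph (Fin 17)) : Prop where
  ham : ∀ i : Fin 17, G.Adj i (i + 1)
  edges : G.edgeSet.ncard ≤ 22
  cyc : ∀ k, 3 ≤ k → k ≤ 17 → cycleCount G k = 2

def hamB (u v : Fin 17) : Prop := v = u + 1 ∨ u = v + 1

instance : DecidableRel hamB := fun u v => by unfold hamB; infer_instance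

/-- number of (ordered) cycle edges inside a set -/
def hp (S : Finset (Fin 17)) : ℕ := ((S ×ˢ S).filter (fun p => hamB p.1 p.2)).card

lemma hp_map (σ : Fin 17 ≃ Fin 17) (hσ : ∀ u v, hamB (σ u) (σ v) ↔ hamB u v)
    (S : Finset (Fin 17)) : hp (S.map σ.toEmbedding) = hp S := by
  unfold hp
  symm
  apply Finset.card_bij (fun p _ => (σ p.1, σ p.2))
  · rintro ⟨u, v⟩ h
    simp only [Finset.mem_filter, Finset.mem_product] at h ⊢
    exact ⟨⟨by simpa using h.1.1, by simpa using h.1.2⟩, (hσ u v).2 h.2⟩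
  · rintro ⟨u, v⟩ _ ⟨u', v'⟩ _ h
    simpa using h
  · rintro ⟨u, v⟩ h
    simp only [Finset.mem_filter, Finset.mem_product] at h
    refine ⟨(σ.symm u, σ.symm v), ?_, by simp⟩
    simp only [Finset.mem_filter, Finset.mem_product]
    refine ⟨⟨?_, ?_⟩, ?_⟩
    · simpa using h.1.1
    · simpa using h.1.2
    · rw [← hσ]; simpa using h.2

lemma nice_map {G : SimpleGraph (Fin 17)} (hG : Nice G) (σ : Fin 17 ≃ Fin 17)
    (hσ : ∀ u v, hamB (σ u) (σ v) ↔ hamB u v) : Nice (G.map σ.toEmbedding) := by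
  have φ : G ≃g G.map σ.toEmbedding := Iso.map σ G
  refine ⟨?_, ?_, ?_⟩
  · intro i
    have h := (hσ (σ.symm i) (σ.symm (i + 1))).1 (by simp [hamB])
    have h2 : G.Adj (σ.symm i) (σ.symm (i + 1)) := by
      rcases h with h | h
      · rw [h]; exact hG.ham _
      · rw [h]; exact (hG.ham _).symm
    have h3 := (map_adj_apply (f := σ.toEmbedding)).2 h2
    simpa using h3
  · rw [← edge_ncard_congr φ]; exact hG.edges
  · intro k h3 h17
    rw [← cycleCount_congr φ k h3]; exact hG.cyc k h3 h17

lemma clique_map {G : SimpleGraph (Fin 17)} {S : Finset (Fin 17)} (h : G.IsNClique 3 S)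
    (σ : Fin 17 ≃ Fin 17) : (G.map σ.toEmbedding).IsNClique 3 (S.map σ.toEmbedding) := h.map

/-- reachable by symmetry -/
def Red (G : SimpleGraph (Fin 17)) (S1 S2 : Finset (Fin 17)) : Prop :=
  Nice G ∧ G.IsNClique 3 S1 ∧ G.IsNClique 3 S2 ∧ S1 ≠ S2 ∧ hp S2 ≤ hp S1

lemma red_map {G : SimpleGraph (Fin 17)} {S1 S2 : Finset (Fin 17)} (h : Red G S1 S2)
    (σ : Fin 17 ≃ Fin 17) (hσ : ∀ u v, hamB (σ u) (σ v) ↔ hamB u v) :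
    Red (G.map σ.toEmbedding) (S1.map σ.toEmbedding) (S2.map σ.toEmbedding) := by
  refine ⟨nice_map h.1 σ hσ, clique_map h.2.1 σ, clique_map h.2.2.1 σ, ?_, ?_⟩
  · intro h'
    exact h.2.2.2.1 (Finset.map_injective _ h')
  · rw [hp_map σ hσ, hp_map σ hσ]; exact h.2.2.2.2

lemma rot_ham : ∀ p u v : Fin 17, hamB (u - p) (v - p) ↔ hamB u v := by decide +kernel
lemma ref_ham : ∀ p u v : Fin 17, hamB (p - u) (p - v) ↔ hamB u v := by decide +kernel

lemma sort3 {S : Finset (Fin 17)} (h : S.card = 3) :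
    ∃ x y z : Fin 17, x < y ∧ y < z ∧ S = {x, y, z} := by
  obtain ⟨a, b, c, hab, hac, hbc, rfl⟩ := Finset.card_eq_three.1 h
  have key : ∀ a b c : Fin 17, a ≠ b → a ≠ c → b ≠ c →
      (a < b ∧ b < c) ∨ (a < c ∧ c < b) ∨ (b < a ∧ a < c) ∨ (b < c ∧ c < a) ∨ (c < a ∧ a < b) ∨
      (c < b ∧ b < a) := by
    intro a b c; simp only [Fin.lt_def, Fin.ext_iff, ne_eq]; omega
  rcases key a b c hab hac hbc with h | h | h | h | h | h
  · exact ⟨a, b, c, h.1, h.2, rfl⟩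
  · exact ⟨a, c, b, h.1, h.2, by ext; simp; tauto⟩
  · exact ⟨b, a, c, h.1, h.2, by ext; simp; tauto⟩
  · exact ⟨b, c, a, h.1, h.2, by ext; simp; tauto⟩
  · exact ⟨c, a, b, h.1, h.2, by ext; simp; tauto⟩
  · exact ⟨c, b, a, h.1, h.2, by ext; simp; tauto⟩

def gd (a b : Fin 17) : Prop := 0 < a.val ∧ 2 * a.val ≤ b.val ∧ 2 * b.val ≤ 17 + a.val

instance : DecidableRel gd := fun u v => by unfold gd; infer_instance

lemma norm_aux : ∀ x y z : Fin 17, x < y → y < z →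
    gd (y - x) (z - x) ∨ gd (z - y) (x - y) ∨ gd (x - z) (y - z) ∨
    gd (x - z) (x - y) ∨ gd (z - y) (z - x) ∨ gd (y - x) (y - z) := by decide +kernel

lemma exists_norm {S : Finset (Fin 17)} (h : S.card = 3) :
    ∃ σ : Fin 17 ≃ Fin 17, (∀ u v, hamB (σ u) (σ v) ↔ hamB u v) ∧
      ∃ a b, gd a b ∧ S.map σ.toEmbedding = {0, a, b} := by
  obtain ⟨x, y, z, hxy, hyz, rfl⟩ := sort3 h
  have perm : ∀ p q r : Fin 17, ({p, q, r} : Finset (Fin 17)) = {x, y, z} →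
      gd (q - p) (r - p) ∨ gd (p - q) (p - r) →
      ∃ σ : Fin 17 ≃ Fin 17, (∀ u v, hamB (σ u) (σ v) ↔ hamB u v) ∧
      ∃ a b, gd a b ∧ ({x, y, z} : Finset (Fin 17)).map σ.toEmbedding = {0, a, b} := by
    intro p q r hp hg
    rcases hg with hg | hg
    · refine ⟨Equiv.subRight p, rot_ham p, _, _, hg, ?_⟩
      rw [← hp]
      simp [Finset.map_insert]
    · refine ⟨Equiv.subLeft p, ref_ham p, _, _, hg, ?_⟩
      rw [← hp]
      simp [Finset.map_insert]
  rcases norm_aux x y z hxy hyz with h | h | h | h | h | h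
  · exact perm x y z rfl (Or.inl h)
  · exact perm y z x (by ext; simp; tauto) (Or.inl h)
  · exact perm z x y (by ext; simp; tauto) (Or.inl h)
  · exact perm x z y (by ext; simp; tauto) (Or.inr h)
  · exact perm z y x (by ext; simp; tauto) (Or.inr h)
  · exact perm y x z (by ext; simp; tauto) (Or.inr h)

lemma lex_aux : ∀ x y z : Fin 17, x < y → y < z → lexR x y z = true ∨
    (2 - z < 2 - y ∧ 2 - y < 2 - x ∧ lexR (2 - z : Fin 17) (2 - y : Fin 17) (2 - x : Fin 17) = true) ∨
    (2 - y < 2 - x ∧ 2 - x < 2 - z ∧ lexR (2 - y : Fin 17) (2 - x : Fin 17) (2 - z : Fin 17) = true) ∨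
    (2 - x < 2 - z ∧ 2 - z < 2 - y ∧ lexR (2 - x : Fin 17) (2 - z : Fin 17) (2 - y : Fin 17) = true) := by
  decide +kernel

lemma gd_two {a b : Fin 17} (h : gd a b) (hb : b.val = 2) : a = 1 ∧ b = 2 := by
  unfold gd at h
  constructor
  · apply Fin.ext; simp only [Fin.val_one]; omega
  · apply Fin.ext; simpa using hb

/-- full normal form -/
lemma exists_normal {G : SimpleGraph (Fin 17)} {S1 S2 : Finset (Fin 17)} (h : Red G S1 S2) :
    ∃ G' : SimpleGraph (Fin 17), Nonempty (G ≃g G') ∧ ∃ a b x y z : Fin 17, gd a b ∧ x < y ∧ y < z ∧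
      Red G' {0, a, b} {x, y, z} ∧ (b.val = 2 → lexR x y z = true) := by
  obtain ⟨σ, hσ, a, b, hg, hS⟩ := exists_norm h.2.1.card_eq
  have hr := red_map h σ hσ
  rw [hS] at hr
  obtain ⟨x, y, z, hxy, hyz, hS2⟩ := sort3 hr.2.2.1.card_eq
  rw [hS2] at hr
  by_cases hb : b.val = 2 → lexR x y z = true
  · exact ⟨_, ⟨Iso.map σ G⟩, a, b, x, y, z, hg, hxy, hyz, hr, hb⟩
  · push Not at hb
    obtain ⟨hb, hl⟩ := hb
    obtain ⟨rfl, rfl⟩ := gd_two hg hb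
    have hr2 := red_map hr (Equiv.subLeft 2) (ref_ham 2)
    have e1 : ({0, 1, 2} : Finset (Fin 17)).map (Equiv.subLeft (2 : Fin 17)).toEmbedding
      = {0, 1, 2} := by decide +kernel
    rw [e1] at hr2
    have e2 : ({x, y, z} : Finset (Fin 17)).map (Equiv.subLeft (2 : Fin 17)).toEmbedding
      = {2 - x, 2 - y, 2 - z} := by simp [Finset.map_insert]
    rw [e2] at hr2
    have φ : G ≃g (G.map σ.toEmbedding).map (Equiv.subLeft (2 : Fin 17)).toEmbedding :=
      (Iso.map σ G).trans (Iso.map _ _)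
    have fin : ∀ p q r : Fin 17, ({2 - x, 2 - y, 2 - z} : Finset (Fin 17)) = {p, q, r} →
        p < q ∧ q < r ∧ lexR p q r = true → ∃ G' : SimpleGraph (Fin 17), Nonempty (G ≃g G') ∧
        ∃ a b x y z : Fin 17, gd a b ∧ x < y ∧ y < z ∧
        Red G' {0, a, b} {x, y, z} ∧ (b.val = 2 → lexR x y z = true) := by
      intro p q r he hp
      rw [he] at hr2
      exact ⟨_, ⟨φ⟩, 1, 2, p, q, r, hg, hp.1, hp.2.1, hr2, fun _ => hp.2.2⟩
    rcases lex_aux x y z hxy hyz with h | h | h | h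
    · exact absurd h hl
    · exact fin _ _ _ (by ext; simp; tauto) h
    · exact fin _ _ _ (by ext; simp; tauto) h
    · exact fin _ _ _ (by ext; simp; tauto) h

/-- two triangles -/
lemma exists_red {G : SimpleGraph (Fin 17)} (hG : Nice G) : ∃ S1 S2, Red G S1 S2 := by
  classical
  have h := hG.cyc 3 le_rfl (by norm_num)
  rw [cycleCount_eq G 0, Set.ncard_eq_two] at h
  obtain ⟨E1, E2, hne, hE⟩ := h
  have key : ∀ E, E ∈ ({E1, E2} : Set (Finset (Sym2 (Fin 17)))) →
      ∃ f : Fin 3 → Fin 17, Function.Injective f ∧ E = cycE (n := 0) f ∧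
        G.IsNClique 3 (Finset.univ.image f) := by
    intro E h
    rw [← hE] at h
    obtain ⟨h1, h2, h3⟩ := h
    obtain ⟨n, f, hf, rfl⟩ := minEven_cyc h2 (fun e he => G.not_isDiag_of_mem_edgeSet (by
      have := h1 he; simpa using this))
    rw [cycE_card hf] at h3
    obtain rfl : n = 0 := by omega
    refine ⟨f, hf, rfl, ?_, by rw [Finset.card_image_of_injective _ hf]; rfl⟩
    have hadj : ∀ i : Fin 3, G.Adj (f i) (f (i + 1)) := by
      intro i
      have := h1 (Finset.mem_image_of_mem (fun i : Fin 3 => s(f i, f (i + 1))) (Finset.mem_univ i))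
      simpa using this
    have hadj2 : ∀ i j : Fin 3, i ≠ j → G.Adj (f i) (f j) := by
      intro i j hij
      have : ∀ i j : Fin 3, i ≠ j → j = i + 1 ∨ i = j + 1 := by decide
      rcases this i j hij with rfl | rfl
      · exact hadj i
      · exact (hadj j).symm
    intro u hu v hv huv
    simp only [Finset.coe_image, Finset.coe_univ, Set.image_univ, Set.mem_range] at hu hv
    obtain ⟨i, rfl⟩ := hu
    obtain ⟨j, rfl⟩ := hv
    exact hadj2 i j (fun h => huv (by rw [h]))
  obtain ⟨f1, hf1, he1, hc1⟩ := key E1 (by simp)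
  obtain ⟨f2, hf2, he2, hc2⟩ := key E2 (by simp)
  have hcyc : ∀ f : Fin 3 → Fin 17, Function.Injective f → cycE (n := 0) f =
      ((Finset.univ.image f).sym2).filter (fun e => ¬ e.IsDiag) := by
    intro f hf
    ext e
    induction e with | _ u v
    simp only [cycE, Finset.mem_image, Finset.mem_univ, true_and, Finset.mem_filter,
      Finset.mk_mem_sym2_iff, Sym2.mk_isDiag_iff]
    constructor
    · rintro ⟨i, hi⟩
      have hne := fin_add_one_ne (n := 0) i
      rcases Sym2.eq_iff.1 hi with ⟨rfl, rfl⟩ | ⟨rfl, rfl⟩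
      · exact ⟨⟨⟨_, rfl⟩, ⟨_, rfl⟩⟩, fun h => hne (hf h).symm⟩
      · exact ⟨⟨⟨_, rfl⟩, ⟨_, rfl⟩⟩, fun h => hne (hf h)⟩
    · rintro ⟨⟨⟨i, rfl⟩, ⟨j, rfl⟩⟩, h⟩
      have : ∀ i j : Fin 3, i ≠ j → j = i + 1 ∨ i = j + 1 := by decide
      rcases this i j (fun h' => h (by rw [h'])) with rfl | rfl
      · exact ⟨i, rfl⟩
      · exact ⟨j, Sym2.eq_swap⟩
  have hSne : Finset.univ.image f1 ≠ Finset.univ.image f2 := by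
    intro h
    apply hne
    rw [he1, he2, hcyc f1 hf1, hcyc f2 hf2, h]
  rcases le_total (hp (Finset.univ.image f1)) (hp (Finset.univ.image f2)) with h | h
  · exact ⟨_, _, hG, hc2, hc1, hSne.symm, h⟩
  · exact ⟨_, _, hG, hc1, hc2, hSne, h⟩

end Invariance

theorem chkZ_1_2_0 : chkZ 1 2 0 = true := by decide +kernel
theorem chkZ_1_2_1 : chkZ 1 2 1 = true := by decide +kernel
theorem chkZ_1_2_2 : chkZ 1 2 2 = true := by decide +kernel
theorem chkZ_1_2_3 : chkZ 1 2 3 = true := by decide +kernel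
theorem chkZ_1_2_4 : chkZ 1 2 4 = true := by decide +kernel
theorem chkZ_1_2_5 : chkZ 1 2 5 = true := by decide +kernel
theorem chkZ_1_2_6 : chkZ 1 2 6 = true := by decide +kernel
theorem chkZ_1_2_7 : chkZ 1 2 7 = true := by decide +kernel
theorem chkZ_1_2_8 : chkZ 1 2 8 = true := by decide +kernel
theorem chkZ_1_2_9 : chkZ 1 2 9 = true := by decide +kernel
theorem chkZ_1_2_10 : chkZ 1 2 10 = true := by decide +kernel
theorem chkZ_1_2_11 : chkZ 1 2 11 = true := by decide +kernel
theorem chkZ_1_2_12 : chkZ 1 2 12 = true := by decide +kernel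
theorem chkZ_1_2_13 : chkZ 1 2 13 = true := by decide +kernel
theorem chkZ_1_2_14 : chkZ 1 2 14 = true := by decide +kernel
theorem chkZ_1_2_15 : chkZ 1 2 15 = true := by decide +kernel
theorem chkZ_1_2_16 : chkZ 1 2 16 = true := by decide +kernel
theorem chk_1_3 : forLt 17 (fun z => chkZ 1 3 z) = true := by decide +kernel
theorem chk_1_4 : forLt 17 (fun z => chkZ 1 4 z) = true := by decide +kernel
theorem chk_1_5 : forLt 17 (fun z => chkZ 1 5 z) = true := by decide +kernel
theorem chk_1_6 : forLt 17 (fun z => chkZ 1 6 z) = true := by decide +kernel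
theorem chk_1_7 : forLt 17 (fun z => chkZ 1 7 z) = true := by decide +kernel
theorem chk_1_8 : forLt 17 (fun z => chkZ 1 8 z) = true := by decide +kernel
theorem chk_1_9 : forLt 17 (fun z => chkZ 1 9 z) = true := by decide +kernel
theorem chk_2_4 : forLt 17 (fun z => chkZ 2 4 z) = true := by decide +kernel
theorem chk_2_5 : forLt 17 (fun z => chkZ 2 5 z) = true := by decide +kernel
theorem chk_2_6 : forLt 17 (fun z => chkZ 2 6 z) = true := by decide +kernel
theorem chk_2_7 : forLt 17 (fun z => chkZ 2 7 z) = true := by decide +kernel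
theorem chk_2_8 : forLt 17 (fun z => chkZ 2 8 z) = true := by decide +kernel
theorem chk_2_9 : forLt 17 (fun z => chkZ 2 9 z) = true := by decide +kernel
theorem chk_3_6 : forLt 17 (fun z => chkZ 3 6 z) = true := by decide +kernel
theorem chk_3_7 : forLt 17 (fun z => chkZ 3 7 z) = true := by decide +kernel
theorem chk_3_8 : forLt 17 (fun z => chkZ 3 8 z) = true := by decide +kernel
theorem chk_3_9 : forLt 17 (fun z => chkZ 3 9 z) = true := by decide +kernel
theorem chk_3_10 : forLt 17 (fun z => chkZ 3 10 z) = true := by decide +kernel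
theorem chk_4_8 : forLt 17 (fun z => chkZ 4 8 z) = true := by decide +kernel
theorem chk_4_9 : forLt 17 (fun z => chkZ 4 9 z) = true := by decide +kernel
theorem chk_4_10 : forLt 17 (fun z => chkZ 4 10 z) = true := by decide +kernel
theorem chk_5_10 : forLt 17 (fun z => chkZ 5 10 z) = true := by decide +kernel
theorem chk_5_11 : forLt 17 (fun z => chkZ 5 11 z) = true := by decide +kernel

lemma forLt_spec (f : ℕ → Bool) : ∀ n, forLt n f = true → ∀ i < n, f i = true := by
  intro n
  induction n with
  | zero => intro _ i hi; omega
  | succ n ih =>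
    intro h i hi
    have h' : sel (f n) (forLt n f) false = true := h
    rw [sel_eq] at h'
    split_ifs at h' with h1
    rcases Nat.lt_succ_iff_lt_or_eq.1 hi with h2 | rfl
    · exact ih h' i h2
    · exact h1

lemma chk_12 (z : ℕ) (hz : z < 17) : chkZ 1 2 z = true := by
  have h : z = 0 ∨ z = 1 ∨ z = 2 ∨ z = 3 ∨ z = 4 ∨ z = 5 ∨ z = 6 ∨ z = 7 ∨ z = 8 ∨ z = 9 ∨ z = 10 ∨ z = 11 ∨ z = 12 ∨ z = 13 ∨ z = 14 ∨ z = 15 ∨ z = 16 := by omega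
  rcases h with rfl | rfl | rfl | rfl | rfl | rfl | rfl | rfl | rfl | rfl | rfl | rfl | rfl | rfl | rfl | rfl | rfl
  · exact chkZ_1_2_0
  · exact chkZ_1_2_1
  · exact chkZ_1_2_2
  · exact chkZ_1_2_3
  · exact chkZ_1_2_4
  · exact chkZ_1_2_5
  · exact chkZ_1_2_6
  · exact chkZ_1_2_7
  · exact chkZ_1_2_8
  · exact chkZ_1_2_9
  · exact chkZ_1_2_10
  · exact chkZ_1_2_11
  · exact chkZ_1_2_12
  · exact chkZ_1_2_13
  · exact chkZ_1_2_14
  · exact chkZ_1_2_15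
  · exact chkZ_1_2_16

lemma chk_all (a b : ℕ) (h0 : 0 < a) (h1 : 2 * a ≤ b) (h2 : 2 * b ≤ 17 + a) :
    ∀ z < 17, chkZ a b z = true := by
  have h : a = 1 ∨ a = 2 ∨ a = 3 ∨ a = 4 ∨ a = 5 := by omega
  rcases h with rfl | rfl | rfl | rfl | rfl
  · have h : b = 2 ∨ b = 3 ∨ b = 4 ∨ b = 5 ∨ b = 6 ∨ b = 7 ∨ b = 8 ∨ b = 9 := by omega
    rcases h with rfl | rfl | rfl | rfl | rfl | rfl | rfl | rfl
    · exact chk_12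
    · exact forLt_spec _ 17 chk_1_3
    · exact forLt_spec _ 17 chk_1_4
    · exact forLt_spec _ 17 chk_1_5
    · exact forLt_spec _ 17 chk_1_6
    · exact forLt_spec _ 17 chk_1_7
    · exact forLt_spec _ 17 chk_1_8
    · exact forLt_spec _ 17 chk_1_9
  · have h : b = 4 ∨ b = 5 ∨ b = 6 ∨ b = 7 ∨ b = 8 ∨ b = 9 := by omega
    rcases h with rfl | rfl | rfl | rfl | rfl | rfl
    · exact forLt_spec _ 17 chk_2_4
    · exact forLt_spec _ 17 chk_2_5
    · exact forLt_spec _ 17 chk_2_6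
    · exact forLt_spec _ 17 chk_2_7
    · exact forLt_spec _ 17 chk_2_8
    · exact forLt_spec _ 17 chk_2_9
  · have h : b = 6 ∨ b = 7 ∨ b = 8 ∨ b = 9 ∨ b = 10 := by omega
    rcases h with rfl | rfl | rfl | rfl | rfl
    · exact forLt_spec _ 17 chk_3_6
    · exact forLt_spec _ 17 chk_3_7
    · exact forLt_spec _ 17 chk_3_8
    · exact forLt_spec _ 17 chk_3_9
    · exact forLt_spec _ 17 chk_3_10
  · have h : b = 8 ∨ b = 9 ∨ b = 10 := by omega
    rcases h with rfl | rfl | rfl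
    · exact forLt_spec _ 17 chk_4_8
    · exact forLt_spec _ 17 chk_4_9
    · exact forLt_spec _ 17 chk_4_10
  · have h : b = 10 ∨ b = 11 := by omega
    rcases h with rfl | rfl
    · exact forLt_spec _ 17 chk_5_10
    · exact forLt_spec _ 17 chk_5_11

/-! ### Classification of graphs containing the standard cycle -/

section Classify

lemma mask_aux : ∀ x y : Fin 17, x < y → isHp x y = true ∨
    (IsCh s(x, y) ∧ chordMask x y = msk s(x, y)) := by decide +kernel

lemma len_aux : ∀ x y z : Fin 17, x < y → y < z →
    2 * lenL (tri x y z []) + hp {x, y, z} = 6 := by decide +kernel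

lemma edg_mem {P : ℕ → Prop} {x y : ℕ} {l : List ℕ} (h1 : isHp x y = true ∨ P (chordMask x y))
    (h2 : ∀ p ∈ l, P p) : ∀ p ∈ edg x y l, P p := by
  intro p hp
  unfold edg at hp
  rw [sel_eq] at hp
  split_ifs at hp with h
  · exact h2 p hp
  · rcases List.mem_cons.1 hp with rfl | h3
    · exact h1.resolve_left h
    · exact h2 p h3

lemma skip_false {a b x y z : Fin 17} (hg : gd a b) (hxy : x < y) (hyz : y < z)
    (hne : ({0, a, b} : Finset (Fin 17)) ≠ {x, y, z}) (hh : hp {x, y, z} ≤ hp {0, a, b})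
    (hl : b.val = 2 → lexR x y z = true) : skip a b x y z = false := by
  have hab : (0 : Fin 17) < a ∧ a < b := by
    unfold gd at hg
    simp only [Fin.lt_def, Fin.val_zero]
    omega
  have e1 := len_aux 0 a b hab.1 hab.2
  have e2 := len_aux x y z hxy hyz
  have e3 : lenL (tri 0 a b []) ≤ lenL (tri x y z []) := by
    simp only [Fin.val_zero] at e1
    omega
  unfold skip
  rw [sel_eq, if_neg, sel_eq, if_neg]
  · rw [sel_eq]
    split_ifs with h
    · rw [hl (Nat.eq_of_beq_eq_true h)]; rfl
    · rfl
  · simp only [sel_eq]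
    split_ifs with h1 h2
    · intro h3
      apply hne
      have a1 := Nat.eq_of_beq_eq_true h1
      have a2 := Nat.eq_of_beq_eq_true h2
      have a3 := Nat.eq_of_beq_eq_true h3
      have b1 : x = 0 := Fin.ext a1
      have b2 : y = a := Fin.ext a2
      have b3 : z = b := Fin.ext a3
      rw [b1, b2, b3]
    · simp
    · simp
  · intro h
    have h2 := Nat.le_of_ble_eq_true h
    omega

lemma edgeSet_mkE {G : SimpleGraph (Fin 17)} [DecidableRel G.Adj] (hG : ∀ i, G.Adj i (i + 1)) :
    G.edgeSet = (mkE (G.edgeFinset.filter IsCh) Finset.univ : Set (Sym2 (Fin 17))) := by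
  have h := exists_mkE (E := G.edgeFinset) (fun e he => G.not_isDiag_of_mem_edgeSet (by simpa using he))
  have hu : Finset.univ.filter (fun i => hE i ∈ G.edgeFinset) = Finset.univ := by
    apply Finset.filter_true_of_mem
    intro i _
    rw [mem_edgeFinset]
    exact hG i
  rw [hu] at h
  rw [← h, coe_edgeFinset]

lemma red_root {G : SimpleGraph (Fin 17)} [DecidableRel G.Adj] {a b x y z : Fin 17}
    (hg : gd a b) (hxy : x < y) (hyz : y < z)
    (hr : Red G {0, a, b} {x, y, z}) (hl : b.val = 2 → lexR x y z = true) :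
    ∃ s ∈ sols, s.toFinset = (G.edgeFinset.filter IsCh).image msk := by
  obtain ⟨hn, hc1, hc2, hne, hh⟩ := hr
  set D := G.edgeFinset.filter IsCh with hDdef
  have hD : ∀ e ∈ D, IsCh e := fun e he => (Finset.mem_filter.1 he).2
  have hGe := edgeSet_mkE hn.ham
  rw [← hDdef] at hGe
  have hcard : D.card ≤ 5 := by
    have h := hn.edges
    rw [hGe, Set.ncard_coe_finset, mkE_card hD] at h
    simp at h
    omega
  have hm := model_of hD G hGe hn.cyc
  have hab : (0 : Fin 17) < a ∧ a < b := by
    unfold gd at hg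
    simp only [Fin.lt_def, Fin.val_zero]
    omega
  have hz := chk_all a b hg.1 hg.2.1 hg.2.2 z z.2
  have hy := forLt_spec _ _ hz y hyz
  have hx := forLt_spec _ _ hy x hxy
  have hx' : chk a b x y z = true := hx
  unfold chk at hx'
  rw [skip_false hg hxy hyz hne hh hl, sel_eq, if_neg (by simp)] at hx'
  refine root_spec hm (Finset.card_image_le.trans hcard) _ ?_ hx'
  have key : ∀ u v : Fin 17, u < v → G.Adj u v →
      isHp u v = true ∨ chordMask u v ∈ D.image msk := by
    intro u v huv hadj
    rcases mask_aux u v huv with h | ⟨h1, h2⟩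
    · exact Or.inl h
    · right
      rw [h2]
      apply Finset.mem_image_of_mem
      rw [hDdef, Finset.mem_filter, mem_edgeFinset]
      exact ⟨hadj, h1⟩
  have ad1 : ∀ u v : Fin 17, u ∈ ({0, a, b} : Finset (Fin 17)) → v ∈ ({0, a, b} : Finset (Fin 17)) →
      u < v → G.Adj u v := fun u v hu hv h => hc1.1 (by exact_mod_cast hu) (by exact_mod_cast hv) h.ne
  have ad2 : ∀ u v : Fin 17, u ∈ ({x, y, z} : Finset (Fin 17)) → v ∈ ({x, y, z} : Finset (Fin 17)) →
      u < v → G.Adj u v := fun u v hu hv h => hc2.1 (by exact_mod_cast hu) (by exact_mod_cast hv) h.ne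
  have t2 : ∀ p ∈ tri x y z [], p ∈ D.image msk := by
    unfold tri
    refine edg_mem (key x y hxy (ad2 _ _ (by simp) (by simp) hxy)) ?_
    refine edg_mem (key y z hyz (ad2 _ _ (by simp) (by simp) hyz)) ?_
    refine edg_mem (key x z (hxy.trans hyz) (ad2 _ _ (by simp) (by simp) (hxy.trans hyz))) ?_
    simp
  have hb := hab.1.trans hab.2
  have k0 := fun (v : Fin 17) => key 0 v
  simp only [Fin.val_zero] at k0
  unfold tri
  refine edg_mem (k0 a hab.1 (ad1 _ _ (by simp) (by simp) hab.1)) ?_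
  refine edg_mem (key a b hab.2 (ad1 _ _ (by simp) (by simp) hab.2)) ?_
  refine edg_mem (k0 b hb (ad1 _ _ (by simp) (by simp) hb)) ?_
  exact t2

/-- the six chord sets -/
def Ds : Fin 6 → Finset (Sym2 (Fin 17)) :=
  ![{s(10, 16), s(0, 11), s(0, 5), s(1, 5), s(0, 2)},
    {s(6, 12), s(5, 11), s(0, 5), s(1, 5), s(0, 2)},
    {s(7, 13), s(6, 12), s(0, 5), s(1, 5), s(0, 2)},
    {s(8, 14), s(7, 13), s(0, 5), s(1, 5), s(0, 2)},
    {s(9, 15), s(8, 14), s(0, 5), s(1, 5), s(0, 2)},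
    {s(10, 16), s(9, 15), s(0, 5), s(1, 5), s(0, 2)}]

def Gsix (i : Fin 6) : SimpleGraph (Fin 17) := fromEdgeSet (mkE (Ds i) Finset.univ : Set (Sym2 (Fin 17)))

def slv (i : Fin 6) : List ℕ := sols.get i

lemma Ds_ch : ∀ i, ∀ e ∈ Ds i, IsCh e := by decide +kernel

lemma Ds_sols : ∀ i : Fin 6, (slv i).toFinset = (Ds i).image msk := by decide +kernel

lemma Ds_card : ∀ i : Fin 6, (Ds i).card = 5 := by decide +kernel

lemma sols_nodup : ∀ i : Fin 6, (slv i).Nodup := by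
  unfold List.Nodup
  decide +kernel

lemma Gsix_edgeSet (i : Fin 6) : (Gsix i).edgeSet = (mkE (Ds i) Finset.univ : Set (Sym2 (Fin 17))) := by
  unfold Gsix
  rw [edgeSet_fromEdgeSet]
  ext e
  constructor
  · intro h; exact h.1
  · intro h; exact ⟨h, mkE_diag (Ds_ch i) _ e h⟩

lemma nice_classify {G : SimpleGraph (Fin 17)} (hG : Nice G) : ∃ i, Nonempty (G ≃g Gsix i) := by
  classical
  obtain ⟨S1, S2, hr⟩ := exists_red hG
  obtain ⟨G', ⟨φ⟩, a, b, x, y, z, hg, hxy, hyz, hr', hl⟩ := exists_normal hr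
  obtain ⟨s, hs, hs'⟩ := red_root hg hxy hyz hr' hl
  obtain ⟨i, rfl⟩ : ∃ i : Fin 6, slv i = s := by
    obtain ⟨i, h⟩ := List.mem_iff_get.1 hs
    exact ⟨i, h⟩
  rw [Ds_sols i] at hs'
  have hD : ∀ e ∈ Ds i ∪ G'.edgeFinset.filter IsCh, IsCh e := by
    intro e he
    rcases Finset.mem_union.1 he with h | h
    · exact Ds_ch i e h
    · exact (Finset.mem_filter.1 h).2
  have h1 := image_msk_inj hD Finset.subset_union_left Finset.subset_union_right hs'
  have h2 := edgeSet_mkE hr'.1.ham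
  rw [← h1, ← Gsix_edgeSet, edgeSet_inj] at h2
  exact ⟨i, ⟨h2 ▸ φ⟩⟩

lemma classify {W : Type} [Fintype W] (G : SimpleGraph W) (hW : Fintype.card W = 17)
    (hE : G.edgeSet.ncard ≤ 22) (hG : IsRPancyclic G 2) : ∃ i, Nonempty (G ≃g Gsix i) := by
  classical
  have hc := hG.2 17 (by norm_num) hW.ge
  have hne : ({H : G.Subgraph | Nonempty (H.coe ≃g cycleGraph 17)}).Nonempty := by
    apply Set.nonempty_of_ncard_ne_zero
    unfold cycleCount at hc
    rw [hc]; norm_num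
  obtain ⟨H, ⟨φ⟩⟩ := hne
  let f : Fin 17 → W := fun i => (φ.symm i : W)
  have hf : Function.Injective f := fun i j h => φ.symm.injective (Subtype.ext h)
  have hadj : ∀ i : Fin 17, G.Adj (f i) (f (i + 1)) := by
    intro i
    have h := (φ.symm.map_adj_iff).2 (cyc_adj (n := 14) i)
    exact H.adj_sub h
  have hb : Function.Bijective f := (Fintype.bijective_iff_injective_and_card f).2 ⟨hf, by simp [hW]⟩
  let e : Fin 17 ≃ W := Equiv.ofBijective f hb
  have ψ : G.comap e ≃g G := Iso.comap e G
  have hn : Nice (G.comap e) := by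
    refine ⟨fun i => hadj i, ?_, ?_⟩
    · rw [edge_ncard_congr ψ]; exact hE
    · intro k h3 h17
      rw [cycleCount_congr ψ k h3]
      exact hG.2 k h3 (by rw [hW]; exact h17)
  obtain ⟨i, ⟨χ⟩⟩ := nice_classify hn
  exact ⟨i, ⟨ψ.symm.trans χ⟩⟩

lemma calc_count : ∀ i : Fin 6, ∀ k : Fin 18, 3 ≤ k.val → (calcM (slv i)).count k.val = 2 := by
  decide +kernel

lemma Gsix_pan (i : Fin 6) : IsRPancyclic (Gsix i) 2 := by
  refine ⟨by simp, ?_⟩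
  intro k h3 h17
  rw [Fintype.card_fin] at h17
  rw [← count_LenM (Ds_ch i) (Gsix i) (Gsix_edgeSet i) k h3]
  have h := (calc_spec (Ds_ch i) (slv i) (sols_nodup i) (Ds_sols i).subset).2
  rw [tot_toFinset (subs_nodup (sols_nodup i))] at h
  have hs : (subs (slv i)).toFinset = ((Ds i).image msk).powerset := by
    ext T
    rw [List.mem_toFinset, mem_subs, Finset.mem_powerset, Ds_sols]
  rw [hs] at h
  rw [← h, Multiset.coe_count]
  exact calc_count i ⟨k, by omega⟩ h3

lemma Gsix_edges (i : Fin 6) : (Gsix i).edgeSet.ncard ≤ 22 := by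
  rw [Gsix_edgeSet, Set.ncard_coe_finset, mkE_card (Ds_ch i), Ds_card]
  simp

/-! Non-isomorphism: the total number of walks with five steps. -/

open Classical in
noncomputable def wk {V : Type*} [Fintype V] (G : SimpleGraph V) : ℕ → V → ℕ
  | 0, _ => 1
  | k + 1, v => ∑ u, if G.Adj v u then wk G k u else 0

lemma wk_iso {V W : Type*} [Fintype V] [Fintype W] {G : SimpleGraph V} {G' : SimpleGraph W}
    (φ : G ≃g G') (k : ℕ) : ∀ v, wk G' k (φ v) = wk G k v := by
  classical
  induction k with
  | zero => intro v; rfl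
  | succ k ih =>
    intro v
    unfold wk
    rw [← φ.toEquiv.sum_comp]
    apply Finset.sum_congr rfl
    intro u _
    have h : φ.toEquiv u = φ u := rfl
    rw [h, ih u]
    apply if_congr _ rfl rfl
    exact φ.map_adj_iff

def wkB (nb : ℕ → ℕ) : ℕ → ℕ → ℕ
  | 0, _ => 1
  | k + 1, v => ((List.range 17).map (fun u => if (nb v).testBit u then wkB nb k u else 0)).sum

def nbT (i : Fin 6) (v : ℕ) : ℕ := 
  ((![[67622, 37, 11, 20, 40, 83, 160, 320, 640, 1280, 68096, 5121, 10240, 20480, 40960, 81920, 33793],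
    [65574, 37, 11, 20, 40, 2131, 4256, 320, 640, 1280, 2560, 5152, 10304, 20480, 40960, 81920, 32769],
    [65574, 37, 11, 20, 40, 83, 4256, 8512, 640, 1280, 2560, 5120, 10304, 20608, 40960, 81920, 32769],
    [65574, 37, 11, 20, 40, 83, 160, 8512, 17024, 1280, 2560, 5120, 10240, 20608, 41216, 81920, 32769],
    [65574, 37, 11, 20, 40, 83, 160, 320, 17024, 34048, 2560, 5120, 10240, 20480, 41216, 82432, 32769],
    [65574, 37, 11, 20, 40, 83, 160, 320, 640, 34048, 68096, 5120, 10240, 20480, 40960, 82432, 33793]] : Fin 6 → List ℕ) i).getD v 0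

lemma nbT_adj : ∀ i : Fin 6, ∀ u v : Fin 17,
    (s(u, v) ∈ mkE (Ds i) Finset.univ ∧ u ≠ v) ↔ (nbT i u).testBit v = true := by decide +kernel

lemma wk_eq (i : Fin 6) (k : ℕ) : ∀ v : Fin 17, wk (Gsix i) k v = wkB (nbT i) k v := by
  classical
  induction k with
  | zero => intro v; rfl
  | succ k ih =>
    intro v
    unfold wk wkB
    have hsum : ∀ f : ℕ → ℕ, ((List.range 17).map f).sum = ∑ u : Fin 17, f u := by
      intro f; rw [← Finset.sum_range]; rfl
    rw [hsum]
    apply Finset.sum_congr rfl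
    intro u _
    rw [ih u]
    apply if_congr _ rfl rfl
    rw [← nbT_adj]
    simp [Gsix]

lemma wk_ne : ∀ i j : Fin 6, i ≠ j → ∑ v : Fin 17, wkB (nbT i) 5 v ≠ ∑ v : Fin 17, wkB (nbT j) 5 v := by
  have h : ∀ i : Fin 6, ∑ v : Fin 17, wkB (nbT i) 5 v = ![3536, 3470, 2924, 2800, 2802, 2936] i := by
    decide +kernel
  intro i j
  rw [h i, h j]
  revert i j
  decide

lemma Gsix_noniso (i j : Fin 6) (hij : i ≠ j) : IsEmpty (Gsix i ≃g Gsix j) := by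
  constructor
  intro φ
  apply wk_ne i j hij
  have h : ∑ v, wk (Gsix j) 5 v = ∑ v, wk (Gsix i) 5 v := by
    rw [← φ.toEquiv.sum_comp]
    exact Finset.sum_congr rfl fun v _ => wk_iso φ 5 v
  simpa only [wk_eq] using h.symm

end Classify

theorem two_pancyclic_count_order_17 : ExactlyNUpToIso 2 6 17 22 :=
  ⟨Gsix, Gsix_noniso, fun i => ⟨Gsix_pan i, Gsix_edges i⟩, fun W _ G hW hE hG => classify G hW hE hG⟩
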